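/- arXiv:2004.00245 — 2 statements merged into one kernel-verified Lean document; each statement's English description precedes it below -/
import Mathlib

section
/- Let r = s + v with s ∈ ℕ₀ and 0 < v ≤ 1 and c₀ > 0. There exist constants c₃, c₄, c₅ > 0 depending only on c₀, r, d and f*, and a constant γ > 0, such that for every n ∈ ℕ and every radial function f* ∈ Lip^{(r,c₀)} of the form f*(x) = g(d^{−1/2}((x^{(1)})² + ⋯ + (x^{(d)})²)) with g ∈ Lip^{(r,c₀)} on [−1,1], there exists a deep ReLU net h_{f*} with 4(d+s+2)(r+1)/τ_r + 8(d+s) + 20 hidden layers and at most c₃ n nonzero free parameters, each bounded in absolute value by c₄ n^{max{1, (r+1)γ, γr/τ_r}}, such that sup_{x ∈ [−1,1]^d} |f*(x) − h_{f*}(x)| ≤ c₅ n^{−r}. -/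
open scoped Classical BigOperators

noncomputable section

/-- The ReLU activation. -/
def relu (t : ℝ) : ℝ := max t 0

/-- The cube `[-1,1]^d`. -/
def cube (d : ℕ) : Set (Fin d → ℝ) := {x | ∀ i, |x i| ≤ 1}

/-- The Euclidean norm on `Fin d → ℝ`. -/
def enorm2 {d : ℕ} (x : Fin d → ℝ) : ℝ := Real.sqrt (∑ i, (x i) ^ 2)

/-- A deep ReLU net with `L` hidden layers on input dimension `d`:
`h₀(x) = x`, `h_{k+1}(x) = σ(W_k h_k(x) + b_k)` componentwise with `σ = relu`,
and output `a ⬝ h_L(x)`. -/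
structure ReLUNet (d : ℕ) where
  L : ℕ
  width : ℕ → ℕ
  width_zero : width 0 = d
  W : (k : ℕ) → Matrix (Fin (width (k + 1))) (Fin (width k)) ℝ
  b : (k : ℕ) → Fin (width (k + 1)) → ℝ
  a : Fin (width L) → ℝ

namespace ReLUNet

variable {d : ℕ}

/-- The vector of hidden-layer values. -/
def hidden (net : ReLUNet d) (x : Fin d → ℝ) : (k : ℕ) → Fin (net.width k) → ℝ
  | 0, i => x (Fin.cast net.width_zero i)
  | k + 1, i => relu ((∑ j, net.W k i j * hidden net x k j) + net.b k i)

/-- The output of the network. -/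
def eval (net : ReLUNet d) (x : Fin d → ℝ) : ℝ :=
  ∑ i, net.a i * net.hidden x net.L i

/-- The number of free (nonzero) parameters of the network: the nonzero entries of
the matrices `W_k` and of the vectors `b_k` (for `k < L`) and of `a`. -/
def numParams (net : ReLUNet d) : ℕ :=
  (∑ k ∈ Finset.range net.L,
      ((Finset.univ.filter fun p : Fin (net.width (k + 1)) × Fin (net.width k) =>
          net.W k p.1 p.2 ≠ 0).card
        + (Finset.univ.filter fun i : Fin (net.width (k + 1)) => net.b k i ≠ 0).card))
    + (Finset.univ.filter fun i : Fin (net.width net.L) => net.a i ≠ 0).card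

/-- All weights, thresholds and outer coefficients are bounded by `R` in absolute value. -/
def paramBound (net : ReLUNet d) (R : ℝ) : Prop :=
  (∀ k < net.L, ∀ i j, |net.W k i j| ≤ R) ∧
    (∀ k < net.L, ∀ i, |net.b k i| ≤ R) ∧
    ∀ i, |net.a i| ≤ R

end ReLUNet

/-- `f` is `(r, c₀)`-smooth on `[-1,1]^d` with `r = s + v`, `0 < v ≤ 1`:
`f` is `s` times differentiable there and every order-`s` partial derivative
(realized by applying the `s`-th derivative to coordinate directions) satisfies the
Hölder/Lipschitz condition of exponent `v` with constant `c₀` in the Euclidean norm. -/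
def LipSmooth (d s : ℕ) (v c₀ : ℝ) (f : (Fin d → ℝ) → ℝ) : Prop :=
  ContDiffOn ℝ s f (cube d) ∧
    ∀ k : Fin s → Fin d, ∀ x ∈ cube d, ∀ x' ∈ cube d,
      |iteratedFDerivWithin ℝ s f (cube d) x (fun j => Pi.single (k j) 1) -
          iteratedFDerivWithin ℝ s f (cube d) x' (fun j => Pi.single (k j) 1)| ≤
        c₀ * (enorm2 (x - x')) ^ v

/-- `τ_r` for `r = s + v`: equal to `1` if `r ≥ 1` and to `v` if `r < 1`. -/
def tauR (s : ℕ) (v : ℝ) : ℝ := if 1 ≤ (s : ℝ) + v then 1 else v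

section Networks

variable {d : ℕ} {ι κ μ : Type} [Fintype ι] [Fintype κ] [Fintype μ]

/-- `1` for nonzero numbers and `0` for zero. -/
def nonzeroInd (t : ℝ) : ℕ := if t = 0 then 0 else 1

lemma nonzeroInd_le_one (t : ℝ) : nonzeroInd t ≤ 1 := by
  unfold nonzeroInd; split_ifs <;> simp

@[simp] lemma nonzeroInd_zero : nonzeroInd 0 = 0 := by simp [nonzeroInd]

@[simp] lemma nonzeroInd_neg (t : ℝ) : nonzeroInd (-t) = nonzeroInd t := by simp [nonzeroInd]

lemma nonzeroInd_mul_le (α t : ℝ) : nonzeroInd (α * t) ≤ nonzeroInd t := by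
  unfold nonzeroInd; split_ifs <;> simp_all

/-- `f` is obtained from `F` by one ReLU layer with at most `P` nonzero parameters,
all bounded by `R`. -/
def IsLayer (R : ℝ) (P : ℕ) (F : (Fin d → ℝ) → ι → ℝ) (f : (Fin d → ℝ) → κ → ℝ) : Prop :=
  ∃ (W : κ → ι → ℝ) (b : κ → ℝ), (∀ i j, |W i j| ≤ R) ∧ (∀ i, |b i| ≤ R) ∧
    ∑ i, ((∑ j, nonzeroInd (W i j)) + nonzeroInd (b i)) ≤ P ∧
    ∀ x i, f x i = relu ((∑ j, W i j * F x j) + b i)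

/-- `f` is the vector of values of hidden layer `L + 1` of a ReLU net with at most `P` nonzero
parameters in its hidden layers, all bounded by `R`. -/
def IsHidden (R : ℝ) : (L : ℕ) → (P : ℕ) → (κ : Type) → [Fintype κ] →
    ((Fin d → ℝ) → κ → ℝ) → Prop
  | 0, P, _, _, f => IsLayer R P (fun x : Fin d → ℝ => x) f
  | L + 1, P, _, _, f => ∃ (ι : Type) (_ : Fintype ι) (F : (Fin d → ℝ) → ι → ℝ) (P' P'' : ℕ),
      IsHidden R L P' ι F ∧ IsLayer R P'' F f ∧ P' + P'' ≤ P

/-- `f` is realized by a ReLU net with `L + 1` hidden layers and at most `P` nonzero parameters,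
all bounded by `R`. -/
def IsRealized (L P : ℕ) (R : ℝ) (f : (Fin d → ℝ) → ℝ) : Prop :=
  ∃ (κ : Type) (_ : Fintype κ) (F : (Fin d → ℝ) → κ → ℝ) (P' : ℕ) (a : κ → ℝ),
    IsHidden R L P' κ F ∧ (∀ i, |a i| ≤ R) ∧ P' + ∑ i, nonzeroInd (a i) ≤ P ∧
    ∀ x, f x = ∑ i, a i * F x i

lemma IsLayer.mono {R R' : ℝ} {P P' : ℕ} {F : (Fin d → ℝ) → ι → ℝ} {f : (Fin d → ℝ) → κ → ℝ}
    (h : IsLayer R P F f) (hR : R ≤ R') (hP : P ≤ P') : IsLayer R' P' F f := by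
  obtain ⟨W, b, hW, hb, hc, hf⟩ := h
  exact ⟨W, b, fun i j => (hW i j).trans hR, fun i => (hb i).trans hR, hc.trans hP, hf⟩

lemma IsHidden.mono {R R' : ℝ} {L P P' : ℕ} {f : (Fin d → ℝ) → κ → ℝ}
    (h : IsHidden R L P κ f) (hR : R ≤ R') (hP : P ≤ P') : IsHidden R' L P' κ f := by
  induction L generalizing κ P P' with
  | zero => exact IsLayer.mono h hR hP
  | succ L ih =>
    obtain ⟨ι, _, F, P₁, P₂, hF, hl, hc⟩ := h
    exact ⟨ι, _, F, P₁, P₂, ih hF le_rfl, hl.mono hR le_rfl, hc.trans hP⟩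

lemma IsRealized.mono {R R' : ℝ} {L P P' : ℕ} {f : (Fin d → ℝ) → ℝ}
    (h : IsRealized L P R f) (hR : R ≤ R') (hP : P ≤ P') : IsRealized L P' R' f := by
  obtain ⟨κ, _, F, P₁, a, hF, ha, hc, hf⟩ := h
  exact ⟨κ, _, F, P₁, a, hF.mono hR le_rfl, fun i => (ha i).trans hR, hc.trans hP, hf⟩

lemma IsLayer.sum_elim_shared {R : ℝ} {P P' : ℕ} {F : (Fin d → ℝ) → ι → ℝ}
    {f : (Fin d → ℝ) → κ → ℝ} {g : (Fin d → ℝ) → μ → ℝ}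
    (hf : IsLayer R P F f) (hg : IsLayer R P' F g) :
    IsLayer R (P + P') F (fun x => Sum.elim (f x) (g x)) := by
  obtain ⟨W, b, hW, hb, hc, hf⟩ := hf
  obtain ⟨W', b', hW', hb', hc', hg⟩ := hg
  refine ⟨Sum.elim W W', Sum.elim b b', ?_, ?_, ?_, ?_⟩
  · rintro (i | i) j <;> simp [hW, hW']
  · rintro (i | i) <;> simp [hb, hb']
  · simpa [Fintype.sum_sum_type] using add_le_add hc hc'
  · rintro x (i | i) <;> simp [hf, hg]

lemma IsLayer.sum_elim {R : ℝ} (hR : 0 ≤ R) {P P' : ℕ} {ν : Type} [Fintype ν]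
    {F : (Fin d → ℝ) → ι → ℝ} {G : (Fin d → ℝ) → ν → ℝ}
    {f : (Fin d → ℝ) → κ → ℝ} {g : (Fin d → ℝ) → μ → ℝ}
    (hf : IsLayer R P F f) (hg : IsLayer R P' G g) :
    IsLayer R (P + P') (fun x => Sum.elim (F x) (G x)) (fun x => Sum.elim (f x) (g x)) := by
  obtain ⟨W, b, hW, hb, hc, hf⟩ := hf
  obtain ⟨W', b', hW', hb', hc', hg⟩ := hg
  refine ⟨Sum.elim (fun i => Sum.elim (W i) 0) (fun i => Sum.elim 0 (W' i)),
    Sum.elim b b', ?_, ?_, ?_, ?_⟩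
  · rintro (i | i) (j | j) <;> simp [hW, hW', hR]
  · rintro (i | i) <;> simp [hb, hb']
  · simpa [Fintype.sum_sum_type] using add_le_add hc hc'
  · rintro x (i | i) <;> simp [hf, hg]

lemma IsHidden.sum_elim {R : ℝ} (hR : 0 ≤ R) {L P P' : ℕ}
    {f : (Fin d → ℝ) → κ → ℝ} {g : (Fin d → ℝ) → μ → ℝ}
    (hf : IsHidden R L P κ f) (hg : IsHidden R L P' μ g) :
    IsHidden R L (P + P') (κ ⊕ μ) (fun x => Sum.elim (f x) (g x)) := by
  cases L with
  | zero => exact IsLayer.sum_elim_shared hf hg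
  | succ L =>
    induction L generalizing κ μ P P' with
    | zero =>
      obtain ⟨ι, _, F, P₁, P₂, hF, hl, hc⟩ := hf
      obtain ⟨ι', _, F', P₁', P₂', hF', hl', hc'⟩ := hg
      exact ⟨ι ⊕ ι', inferInstance, _, P₁ + P₁', P₂ + P₂', IsLayer.sum_elim_shared hF hF',
        hl.sum_elim hR hl', by omega⟩
    | succ L ih =>
      obtain ⟨ι, _, F, P₁, P₂, hF, hl, hc⟩ := hf
      obtain ⟨ι', _, F', P₁', P₂', hF', hl', hc'⟩ := hg
      exact ⟨ι ⊕ ι', inferInstance, _, P₁ + P₁', P₂ + P₂', ih hF hF',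
        hl.sum_elim hR hl', by omega⟩

lemma IsRealized.add {R : ℝ} {L P P' : ℕ} {f g : (Fin d → ℝ) → ℝ} (hR : 0 ≤ R)
    (hf : IsRealized L P R f) (hg : IsRealized L P' R g) :
    IsRealized L (P + P') R (fun x => f x + g x) := by
  obtain ⟨κ, _, F, P₁, a, hF, ha, hc, hf⟩ := hf
  obtain ⟨κ', _, F', P₁', a', hF', ha', hc', hg⟩ := hg
  refine ⟨κ ⊕ κ', inferInstance, _, P₁ + P₁', Sum.elim a a', hF.sum_elim hR hF', ?_, ?_, ?_⟩
  · rintro (i | i) <;> simp [ha, ha']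
  · simp [Fintype.sum_sum_type]; omega
  · intro x; simp [hf, hg]

lemma IsRealized.const_mul {R R' α : ℝ} {L P : ℕ} {f : (Fin d → ℝ) → ℝ} (hR : R ≤ R')
    (hα : |α| * R ≤ R') (hf : IsRealized L P R f) :
    IsRealized L P R' (fun x => α * f x) := by
  obtain ⟨κ, _, F, P₁, a, hF, ha, hc, hf⟩ := hf
  refine ⟨κ, inferInstance, F, P₁, fun i => α * a i, hF.mono hR le_rfl, ?_, ?_, ?_⟩
  · intro i
    rw [abs_mul]
    exact (mul_le_mul_of_nonneg_left (ha i) (abs_nonneg _)).trans hα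
  · refine le_trans ?_ hc
    gcongr
    exact nonzeroInd_mul_le _ _
  · intro x
    simp [hf, Finset.mul_sum, mul_assoc]

lemma relu_sub_relu_neg (t : ℝ) : relu t - relu (-t) = t := by
  unfold relu
  rcases le_total 0 t with h | h
  · rw [max_eq_left h, max_eq_right (by linarith)]; ring
  · rw [max_eq_right h, max_eq_left (by linarith)]; ring

lemma isRealized_const {R c : ℝ} (hR : 1 ≤ R) (hc : |c| ≤ R) :
    IsRealized 0 2 R (fun _ : Fin d → ℝ => c) := by
  refine ⟨Unit, inferInstance, fun _ _ => 1, 1, fun _ => c, ⟨fun _ _ => 0, fun _ => 1, ?_⟩,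
    fun _ => hc, ?_, by simp⟩
  · refine ⟨fun _ _ => by simp; linarith, fun _ => by simpa using hR, ?_, ?_⟩
    · simpa using nonzeroInd_le_one 1
    · simp [relu]
  · have := nonzeroInd_le_one c
    simp
    omega

lemma isRealized_coord {R : ℝ} (hR : 1 ≤ R) (i : Fin d) :
    IsRealized 0 4 R (fun x : Fin d → ℝ => x i) := by
  refine ⟨Bool, inferInstance, fun x c => relu (bif c then x i else - x i), 2,
    fun c => bif c then 1 else -1,
    ⟨fun c j => if j = i then (bif c then 1 else -1) else 0, fun _ => 0, ?_, ?_, ?_, ?_⟩,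
    ?_, ?_, ?_⟩
  · rintro (_ | _) j <;> dsimp <;> split_ifs <;> simp <;> linarith
  · intro _; simp; linarith
  · have h : ∀ c : ℝ, ∑ j, nonzeroInd (if j = i then c else 0) ≤ 1 := fun c => by
      rw [Finset.sum_eq_single i]
      · exact nonzeroInd_le_one _
      · intro j _ hj; simp [hj]
      · simp
    have h1 := h 1
    have h2 := h (-1)
    simp only [Fintype.sum_bool, nonzeroInd_zero, add_zero, cond_true, cond_false]
    omega
  · rintro x (_ | _) <;> simp
  · rintro (_ | _) <;> simp [hR]
  · have h1 := nonzeroInd_le_one 1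
    have h2 := nonzeroInd_le_one (-1)
    simp only [Fintype.sum_bool, cond_true, cond_false]
    omega
  · intro x
    have := relu_sub_relu_neg (x i)
    simp only [Fintype.sum_bool, cond_true, cond_false]
    linarith

/-- Applying a univariate shallow net with `N` neurons costs two further hidden layers. -/
lemma IsRealized.comp_shallow {R R' : ℝ} {L P N : ℕ} {f : (Fin d → ℝ) → ℝ}
    (hR : R ≤ R') (hR' : 1 ≤ R') (hf : IsRealized L P R f) (α w b : ℕ → ℝ)
    (hα : ∀ i < N, |α i| ≤ R') (hw : ∀ i < N, |w i| ≤ R') (hb : ∀ i < N, |b i| ≤ R') :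
    IsRealized (L + 2) (2 * P + 4 * N) R'
      (fun x => ∑ i ∈ Finset.range N, α i * relu (w i * f x + b i)) := by
  obtain ⟨κ, _, F, P₁, a, hF, ha, hc, hf⟩ := hf
  set A := ∑ i, nonzeroInd (a i) with hA
  refine ⟨Fin N, inferInstance, fun x i => relu (w i * f x + b i), (P₁ + 2 * A) + 3 * N,
    fun i => α i, ⟨Bool, inferInstance, fun x c => relu (bif c then f x else - f x),
      P₁ + 2 * A, 3 * N, ⟨κ, inferInstance, F, P₁, 2 * A, hF.mono hR le_rfl,
        ⟨fun c j => bif c then a j else - a j, fun _ => 0, ?_, ?_, ?_, ?_⟩, le_rfl⟩,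
      ⟨fun i c => bif c then w i else - w i, fun i => b i, ?_, ?_, ?_, ?_⟩, le_rfl⟩,
    fun i => hα i i.2, ?_, ?_⟩
  · rintro (_ | _) j <;> simpa using (ha j).trans hR
  · intro _; simp; linarith
  · simp [hA]; omega
  · rintro x (_ | _) <;> simp [hf]
  · rintro i (_ | _) <;> simpa using hw i i.2
  · intro i; exact hb i i.2
  · calc ∑ i : Fin N, ((∑ c : Bool, nonzeroInd (bif c then w i else - w i)) + nonzeroInd (b i))
        ≤ ∑ i : Fin N, 3 := by
          refine Finset.sum_le_sum fun i _ => ?_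
          have h1 := nonzeroInd_le_one (w i)
          have h2 := nonzeroInd_le_one (b i)
          simp
          omega
      _ = 3 * N := by simp [mul_comm]
  · intro x i
    have := relu_sub_relu_neg (f x)
    have h : w i * f x = ∑ c : Bool, (bif c then w i else - w i) *
        relu (bif c then f x else - f x) := by
      simp only [Fintype.sum_bool, cond_true, cond_false]
      linear_combination (- w i) * this
    exact congrArg (fun t => relu (t + b i)) h
  · have : ∑ i : Fin N, nonzeroInd (α i) ≤ N := by
      calc _ ≤ ∑ i : Fin N, 1 := Finset.sum_le_sum fun i _ => nonzeroInd_le_one _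
        _ = N := by simp
    dsimp only
    omega
  · intro x
    exact Finset.sum_range (fun i => α i * relu (w i * f x + b i))

/-- The net with widths `w` whose parameters are given by families indexed by `ℕ`. -/
def netOfFamilies (L : ℕ) (w : ℕ → ℕ) (hw : w 0 = d) (W : ℕ → ℕ → ℕ → ℝ) (b : ℕ → ℕ → ℝ)
    (a : ℕ → ℝ) : ReLUNet d where
  L := L
  width := w
  width_zero := hw
  W k := fun i j => W k i j
  b k := fun i => b k i
  a := fun i => a i

/-- The values of the hidden neurons of `netOfFamilies`. -/
def familyHidden (w : ℕ → ℕ) (W : ℕ → ℕ → ℕ → ℝ) (b : ℕ → ℕ → ℝ) (x : Fin d → ℝ) :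
    ℕ → ℕ → ℝ
  | 0, i => if h : i < d then x ⟨i, h⟩ else 0
  | k + 1, i => relu ((∑ j ∈ Finset.range (w k), W k i j * familyHidden w W b x k j) + b k i)

lemma hidden_netOfFamilies (L : ℕ) (w : ℕ → ℕ) (hw : w 0 = d) (W : ℕ → ℕ → ℕ → ℝ)
    (b : ℕ → ℕ → ℝ) (a : ℕ → ℝ) (x : Fin d → ℝ) (k : ℕ) (i : Fin (w k)) :
    (netOfFamilies L w hw W b a).hidden x k i = familyHidden w W b x k i := by
  induction k with
  | zero =>
    have : (i : ℕ) < d := hw ▸ i.2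
    simp only [ReLUNet.hidden, familyHidden, this, dif_pos]
    rfl
  | succ k ih =>
    simp only [ReLUNet.hidden, familyHidden]
    congr 2
    rw [Finset.sum_range]
    exact Finset.sum_congr rfl fun j _ => by rw [← ih j]; rfl

lemma familyHidden_congr {w w' : ℕ → ℕ} {W W' : ℕ → ℕ → ℕ → ℝ} {b b' : ℕ → ℕ → ℝ}
    {K : ℕ} (hw : ∀ k < K, w k = w' k) (hW : ∀ k < K, W k = W' k) (hb : ∀ k < K, b k = b' k)
    (x : Fin d → ℝ) : familyHidden w W b x K = familyHidden w' W' b' x K := by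
  induction K with
  | zero => rfl
  | succ K ih =>
    funext i
    simp only [familyHidden, hw K (by omega), hW K (by omega), hb K (by omega),
      ih (fun k hk => hw k (by omega)) (fun k hk => hW k (by omega)) (fun k hk => hb k (by omega))]

/-- Number of nonzero parameters of the layer `k` of `netOfFamilies`. -/
def familyCost (w : ℕ → ℕ) (W : ℕ → ℕ → ℕ → ℝ) (b : ℕ → ℕ → ℝ) (k : ℕ) : ℕ :=
  ∑ i ∈ Finset.range (w (k + 1)),
    ((∑ j ∈ Finset.range (w k), nonzeroInd (W k i j)) + nonzeroInd (b k i))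

lemma card_filter_ne_zero (f : ι → ℝ) :
    (Finset.univ.filter fun i => f i ≠ 0).card = ∑ i, nonzeroInd (f i) := by
  rw [Finset.card_filter]
  refine Finset.sum_congr rfl fun i _ => ?_
  unfold nonzeroInd
  split_ifs <;> simp_all

lemma numParams_netOfFamilies (L : ℕ) (w : ℕ → ℕ) (hw : w 0 = d) (W : ℕ → ℕ → ℕ → ℝ)
    (b : ℕ → ℕ → ℝ) (a : ℕ → ℝ) :
    (netOfFamilies L w hw W b a).numParams =
      ∑ k ∈ Finset.range L, familyCost w W b k + ∑ i ∈ Finset.range (w L), nonzeroInd (a i) := by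
  unfold ReLUNet.numParams
  congr 1
  · refine Finset.sum_congr rfl fun k _ => ?_
    rw [familyCost, Finset.sum_add_distrib]
    congr 1
    · refine (card_filter_ne_zero
        (fun p : Fin (w (k + 1)) × Fin (w k) => W k p.1 p.2)).trans ?_
      rw [Fintype.sum_prod_type, Finset.sum_range]
      exact Finset.sum_congr rfl fun i _ => by rw [Finset.sum_range]
    · refine (card_filter_ne_zero (fun i : Fin (w (k + 1)) => b k i)).trans ?_
      rw [Finset.sum_range]
  · refine (card_filter_ne_zero (fun i : Fin (w L) => a i)).trans ?_
    rw [Finset.sum_range]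

/-- Extension by zero to `ℕ` of a family, along an enumeration of the index type. -/
def extendNat (f : κ → ℝ) (i : ℕ) : ℝ :=
  if h : i < Fintype.card κ then f ((Fintype.equivFin κ).symm ⟨i, h⟩) else 0

lemma extendNat_cases (f : κ → ℝ) (i : ℕ) : (∃ k, extendNat f i = f k) ∨ extendNat f i = 0 := by
  unfold extendNat
  split_ifs with h
  · exact Or.inl ⟨_, rfl⟩
  · exact Or.inr rfl

lemma abs_extendNat_le {f : κ → ℝ} {R : ℝ} (hR : 0 ≤ R) (hf : ∀ k, |f k| ≤ R) (i : ℕ) :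
    |extendNat f i| ≤ R := by
  rcases extendNat_cases f i with ⟨k, h⟩ | h <;> rw [h]
  · exact hf k
  · simpa using hR

@[simp] lemma extendNat_equivFin (f : κ → ℝ) (k : κ) :
    extendNat f (Fintype.equivFin κ k) = f k := by
  simp [extendNat]

lemma sum_range_card_eq {M : Type} [AddCommMonoid M] (f : ℕ → M) :
    ∑ i ∈ Finset.range (Fintype.card κ), f i = ∑ k : κ, f (Fintype.equivFin κ k) := by
  rw [Finset.sum_range]
  exact (Equiv.sum_comp (Fintype.equivFin κ) (fun i => f i)).symm

lemma IsLayer.exists_families {R : ℝ} (hR : 0 ≤ R) {P : ℕ} {F : (Fin d → ℝ) → ι → ℝ}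
    {f : (Fin d → ℝ) → κ → ℝ} (h : IsLayer R P F f) (e : ι ≃ Fin (Fintype.card ι)) :
    ∃ (W : ℕ → ℕ → ℝ) (b : ℕ → ℝ), (∀ i j, |W i j| ≤ R) ∧ (∀ i, |b i| ≤ R) ∧
      ∑ i ∈ Finset.range (Fintype.card κ),
        ((∑ j ∈ Finset.range (Fintype.card ι), nonzeroInd (W i j)) + nonzeroInd (b i)) ≤ P ∧
      ∀ x (H : ℕ → ℝ), (∀ j, H (e j) = F x j) → ∀ k,
        relu ((∑ j ∈ Finset.range (Fintype.card ι), W (Fintype.equivFin κ k) j * H j) +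
          b (Fintype.equivFin κ k)) = f x k := by
  obtain ⟨W, b, hW, hb, hc, hf⟩ := h
  have key : ∀ {M : Type} [AddCommMonoid M] (q : ℕ → M),
      ∑ i ∈ Finset.range (Fintype.card ι), q i = ∑ k : ι, q (e k) := by
    intro M _ q
    rw [Finset.sum_range]
    exact (Equiv.sum_comp e (fun i => q i)).symm
  let V : κ → ℕ → ℝ := fun k j => if h : j < Fintype.card ι then W k (e.symm ⟨j, h⟩) else 0
  have hV : ∀ k j, V k (e j) = W k j := fun k j => by simp [V]
  refine ⟨fun i j => extendNat (fun k => V k j) i, extendNat b, ?_, ?_, ?_, ?_⟩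
  · intro i j
    refine abs_extendNat_le hR (fun k => ?_) i
    dsimp only [V]
    split_ifs
    · exact hW _ _
    · simpa using hR
  · exact abs_extendNat_le hR hb
  · simp only [sum_range_card_eq (κ := κ), key, extendNat_equivFin, hV]
    exact hc
  · intro x H hH k
    simp only [key, extendNat_equivFin, hV, hH]
    exact (hf x k).symm

lemma IsHidden.exists_families {R : ℝ} (hR : 0 ≤ R) {L P : ℕ} {f : (Fin d → ℝ) → κ → ℝ}
    (h : IsHidden R L P κ f) :
    ∃ (w : ℕ → ℕ) (W : ℕ → ℕ → ℕ → ℝ) (b : ℕ → ℕ → ℝ), w 0 = d ∧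
      w (L + 1) = Fintype.card κ ∧
      (∀ k i j, |W k i j| ≤ R) ∧ (∀ k i, |b k i| ≤ R) ∧
      ∑ k ∈ Finset.range (L + 1), familyCost w W b k ≤ P ∧
      ∀ x k, familyHidden w W b x (L + 1) (Fintype.equivFin κ k) = f x k := by
  induction L generalizing κ P with
  | zero =>
    obtain ⟨W, b, hW, hb, hc, hf⟩ := IsLayer.exists_families hR h
      (finCongr (Fintype.card_fin d).symm)
    refine ⟨fun k => if k = 0 then d else Fintype.card κ, fun _ => W, fun _ => b, by simp,
      by simp, fun _ => hW, fun _ => hb, ?_, ?_⟩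
    · simpa [familyCost] using hc
    · intro x k
      have := hf x (fun i => if h : i < d then x ⟨i, h⟩ else 0) (fun j => by simp) k
      rw [Fintype.card_fin] at this
      exact this
  | succ L ih =>
    obtain ⟨ι, _, F, P₁, P₂, hF, hl, hc⟩ := h
    obtain ⟨w, W, b, hw0, hwL, hW, hb, hP, hH⟩ := ih hF
    obtain ⟨W', b', hW', hb', hc', hf'⟩ := hl.exists_families hR (Fintype.equivFin ι)
    set w₂ : ℕ → ℕ := fun k => if k = L + 2 then Fintype.card κ else w k
    set W₂ : ℕ → ℕ → ℕ → ℝ := fun k => if k = L + 1 then W' else W k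
    set b₂ : ℕ → ℕ → ℝ := fun k => if k = L + 1 then b' else b k
    have e1 : ∀ k < L + 2, w₂ k = w k := fun k hk => if_neg (by omega)
    have e2 : ∀ k < L + 1, W₂ k = W k := fun k hk => if_neg (by omega)
    have e3 : ∀ k < L + 1, b₂ k = b k := fun k hk => if_neg (by omega)
    have e4 : w₂ (L + 2) = Fintype.card κ := if_pos rfl
    have e5 : W₂ (L + 1) = W' := if_pos rfl
    have e6 : b₂ (L + 1) = b' := if_pos rfl
    refine ⟨w₂, W₂, b₂, (e1 0 (by omega)).trans hw0, e4, ?_, ?_, ?_, ?_⟩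
    · intro k i j
      dsimp only [W₂]
      split_ifs
      exacts [hW' i j, hW k i j]
    · intro k i
      dsimp only [b₂]
      split_ifs
      exacts [hb' i, hb k i]
    · rw [Finset.sum_range_succ]
      refine le_trans (add_le_add ?_ ?_) hc
      · refine le_trans (le_of_eq (Finset.sum_congr rfl fun k hk => ?_)) hP
        have hk := Finset.mem_range.1 hk
        unfold familyCost
        rw [e1 k (by omega), e1 (k + 1) (by omega), e2 k hk, e3 k hk]
      · unfold familyCost
        rw [e4, e5, e6, e1 (L + 1) (by omega), hwL]
        exact hc'
    · intro x k
      rw [familyHidden, e5, e6, e1 (L + 1) (by omega), hwL]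
      refine hf' x _ (fun j => ?_) k
      rw [← hH x j]
      exact congrFun (familyHidden_congr (fun k hk => e1 k (by omega)) e2 e3 x) _

lemma IsRealized.exists_net {R : ℝ} (hR : 0 ≤ R) {L P : ℕ} {f : (Fin d → ℝ) → ℝ}
    (h : IsRealized L P R f) :
    ∃ net : ReLUNet d, net.L = L + 1 ∧ net.numParams ≤ P ∧ net.paramBound R ∧
      ∀ x, net.eval x = f x := by
  obtain ⟨κ, _, F, P₁, a, hF, ha, hc, hf⟩ := h
  obtain ⟨w, W, b, hw0, hwL, hW, hb, hP, hH⟩ := hF.exists_families hR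
  refine ⟨netOfFamilies (L + 1) w hw0 W b (extendNat a), rfl, ?_, ⟨?_, ?_, ?_⟩, ?_⟩
  · rw [numParams_netOfFamilies, hwL, sum_range_card_eq]
    simp only [extendNat_equivFin]
    omega
  · intro k _ i j; exact hW k i j
  · intro k _ i; exact hb k i
  · intro i; exact abs_extendNat_le hR ha _
  · intro x
    rw [hf]
    calc _ = ∑ i : Fin (w (L + 1)), extendNat a i * familyHidden w W b x (L + 1) i :=
          Finset.sum_congr rfl fun i _ => by
            rw [← hidden_netOfFamilies (L + 1) w hw0 W b (extendNat a)]; rfl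
      _ = ∑ i ∈ Finset.range (w (L + 1)), extendNat a i * familyHidden w W b x (L + 1) i := by
          rw [Finset.sum_range]
      _ = _ := by
          rw [hwL, sum_range_card_eq]
          simp [hH]

end Networks

section Interpolation

/-- The piecewise linear function with values `y i` at the nodes `i * h` for `i ≤ N`. -/
def pwLin (h : ℝ) (N : ℕ) (y : ℕ → ℝ) (t : ℝ) : ℝ :=
  y 0 + ∑ i ∈ Finset.range N, ((y (i + 1) - y i) - (y i - y (i - 1))) / h * relu (t - i * h)

lemma sum_slope_changes {h : ℝ} (hh : h ≠ 0) (y : ℕ → ℝ) (k : ℕ) (t : ℝ) :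
    y 0 + ∑ i ∈ Finset.range (k + 1), ((y (i + 1) - y i) - (y i - y (i - 1))) / h * (t - i * h)
      = y k + (y (k + 1) - y k) / h * (t - k * h) := by
  induction k with
  | zero => simp
  | succ k ih =>
    rw [Finset.sum_range_succ, ← add_assoc, ih]
    simp only [Nat.add_sub_cancel]
    push_cast
    field_simp
    ring

lemma pwLin_node {h : ℝ} (hh : 0 < h) {N k : ℕ} (hk : k < N) (y : ℕ → ℝ) {θ : ℝ}
    (h0 : 0 ≤ θ) (h1 : θ ≤ 1) :
    pwLin h N y ((k + θ) * h) = y k + θ * (y (k + 1) - y k) := by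
  have key := sum_slope_changes hh.ne' y k ((k + θ) * h)
  have e : (y (k + 1) - y k) / h * ((k + θ) * h - k * h) = θ * (y (k + 1) - y k) := by
    field_simp; ring
  rw [e] at key
  rw [← key, pwLin]
  congr 1
  rw [← Finset.sum_subset (Finset.range_mono (Nat.succ_le_of_lt hk))]
  · refine Finset.sum_congr rfl fun i hi => ?_
    have hi : (i : ℝ) ≤ k := by exact_mod_cast Nat.lt_succ_iff.1 (Finset.mem_range.1 hi)
    rw [relu, max_eq_left]
    nlinarith
  · intro i _ hi
    have hi : (k : ℝ) + 1 ≤ i := by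
      have : k + 1 ≤ i := by simpa using hi
      exact_mod_cast this
    rw [relu, max_eq_right, mul_zero]
    nlinarith

lemma exists_node {h : ℝ} (hh : 0 < h) {N : ℕ} (hN : 0 < N) {t : ℝ} (h0 : 0 ≤ t)
    (h1 : t ≤ N * h) :
    ∃ k < N, ∃ θ : ℝ, 0 ≤ θ ∧ θ ≤ 1 ∧ t = (k + θ) * h := by
  induction N with
  | zero => omega
  | succ N ih =>
    rcases le_or_gt t (N * h) with ht | ht
    · rcases Nat.eq_zero_or_pos N with rfl | hN'
      · refine ⟨0, by omega, 0, le_rfl, zero_le_one, ?_⟩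
        simp at ht ⊢
        linarith
      · obtain ⟨k, hk, r⟩ := ih hN' ht
        exact ⟨k, by omega, r⟩
    · refine ⟨N, by omega, t / h - N, ?_, ?_, by field_simp; ring⟩
      · rw [sub_nonneg, le_div_iff₀ hh]; exact ht.le
      · rw [sub_le_iff_le_add, div_le_iff₀ hh]
        push_cast at h1
        linarith

lemma abs_pwLin_le {h : ℝ} (hh : 0 < h) {N : ℕ} (hN : 0 < N) {t : ℝ} (h0 : 0 ≤ t)
    (h1 : t ≤ N * h) {y : ℕ → ℝ} {B : ℝ} (hy : ∀ i ≤ N, |y i| ≤ B) :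
    |pwLin h N y t| ≤ B := by
  obtain ⟨k, hk, θ, hθ0, hθ1, rfl⟩ := exists_node hh hN h0 h1
  rw [pwLin_node hh hk y hθ0 hθ1]
  have a1 := abs_le.1 (hy k hk.le)
  have a2 := abs_le.1 (hy (k + 1) hk)
  rw [abs_le]
  constructor <;> nlinarith

/-- Approximation of `t ^ 2` on `[0, 1]` obtained from `q` self-compositions of a sawtooth
function with `n` monotone pieces. -/
def sqApprox (n : ℕ) : ℕ → ℝ → ℝ
  | 0, t => t
  | q + 1, t => pwLin (1 / n) n (fun i => ((i : ℝ) / n) ^ 2) t +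
      (-(1 / (n : ℝ) ^ 2)) * pwLin (1 / n) n (fun i => ((i % 2 : ℕ) : ℝ)) t +
      1 / (n : ℝ) ^ 2 * sqApprox n q (pwLin (1 / n) n (fun i => ((i % 2 : ℕ) : ℝ)) t)

lemma abs_sqApprox_sub_le {n : ℕ} (hn : 0 < n) (q : ℕ) {t : ℝ} (h0 : 0 ≤ t) (h1 : t ≤ 1) :
    |sqApprox n q t - t ^ 2| ≤ (1 / (n : ℝ) ^ 2) ^ q := by
  have hn' : (0 : ℝ) < n := by exact_mod_cast hn
  induction q generalizing t with
  | zero =>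
    simp only [sqApprox, pow_zero]
    rw [abs_le]
    constructor <;> nlinarith
  | succ q ih =>
    obtain ⟨k, hk, θ, hθ0, hθ1, rfl⟩ := exists_node (one_div_pos.2 hn') hn h0
      (by rwa [mul_one_div_cancel hn'.ne'])
    simp only [sqApprox]
    rw [pwLin_node (one_div_pos.2 hn') hk _ hθ0 hθ1, pwLin_node (one_div_pos.2 hn') hk _ hθ0 hθ1]
    set T : ℝ := ((k % 2 : ℕ) : ℝ) + θ * ((((k + 1) % 2 : ℕ) : ℝ) - ((k % 2 : ℕ) : ℝ)) with hT
    have hT' : T = θ ∨ T = 1 - θ := by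
      rcases Nat.mod_two_eq_zero_or_one k with h | h
      · left
        rw [hT, h, Nat.add_mod, h]
        norm_num
      · right
        rw [hT, h, Nat.add_mod, h]
        norm_num
        ring
    have hT0 : 0 ≤ T := by rcases hT' with h | h <;> rw [h] <;> linarith
    have hT1 : T ≤ 1 := by rcases hT' with h | h <;> rw [h] <;> linarith
    have hTe : T - T ^ 2 = θ - θ ^ 2 := by rcases hT' with h | h <;> rw [h]; ring
    have e : ((k : ℝ) / n) ^ 2 + θ * ((((k + 1 : ℕ) : ℝ) / n) ^ 2 - ((k : ℝ) / n) ^ 2) +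
        -(1 / (n : ℝ) ^ 2) * T + 1 / (n : ℝ) ^ 2 * sqApprox n q T - ((k + θ) * (1 / n)) ^ 2 =
        1 / (n : ℝ) ^ 2 * (sqApprox n q T - T ^ 2) := by
      have : -T = - (T ^ 2 + (θ - θ ^ 2)) := by rw [← hTe]; ring
      push_cast
      field_simp
      linear_combination this
    rw [e, abs_mul, pow_succ' (1 / (n : ℝ) ^ 2) q,
      abs_of_pos (show 0 < 1 / (n : ℝ) ^ 2 by positivity)]
    exact mul_le_mul_of_nonneg_left (ih hT0 hT1) (by positivity)

end Interpolation

section Families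

variable {d : ℕ}

/-- The functions `f n` are realized by nets with `2 * k + 1` hidden layers, `O(n)` nonzero
parameters, and parameters bounded by a power of `n`. -/
def IsPolyRealized (k : ℕ) (f : ℕ → (Fin d → ℝ) → ℝ) : Prop :=
  ∃ C K : ℕ, ∀ n : ℕ, 0 < n → IsRealized (2 * k) (C * n) ((C : ℝ) * (n : ℝ) ^ K) (f n)

lemma mul_pow_le_mul_pow {C C' : ℝ} {K K' n : ℕ} (hn : 0 < n) (h0 : 0 ≤ C) (hC : C ≤ C')
    (hK : K ≤ K') : C * (n : ℝ) ^ K ≤ C' * (n : ℝ) ^ K' := by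
  have : (1 : ℝ) ≤ n := by exact_mod_cast hn
  gcongr
  linarith

lemma le_mul_pow {C : ℝ} {K n : ℕ} (hn : 0 < n) (h0 : 0 ≤ C) : C ≤ C * (n : ℝ) ^ K := by
  simpa using mul_pow_le_mul_pow (K := 0) (K' := K) hn h0 le_rfl (Nat.zero_le _)

lemma IsPolyRealized.add {k : ℕ} {f g : ℕ → (Fin d → ℝ) → ℝ} (hf : IsPolyRealized k f)
    (hg : IsPolyRealized k g) : IsPolyRealized k (fun n x => f n x + g n x) := by
  obtain ⟨C, K, hf⟩ := hf
  obtain ⟨C', K', hg⟩ := hg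
  refine ⟨C + C', K + K', fun n hn => ?_⟩
  rw [add_mul]
  refine IsRealized.add (by positivity) ((hf n hn).mono ?_ le_rfl) ((hg n hn).mono ?_ le_rfl) <;>
    refine mul_pow_le_mul_pow hn (by positivity) (by push_cast; simp) (by omega)

lemma IsPolyRealized.const_mul {k : ℕ} {f : ℕ → (Fin d → ℝ) → ℝ} (hf : IsPolyRealized k f)
    (α : ℕ → ℝ) {B : ℝ} (hα : ∀ n, 0 < n → |α n| ≤ B) :
    IsPolyRealized k (fun n x => α n * f n x) := by
  obtain ⟨C, K, hf⟩ := hf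
  obtain ⟨m, hm⟩ := exists_nat_ge B
  refine ⟨(m + 1) * C, K, fun n hn => ?_⟩
  have h0 : (0 : ℝ) ≤ C * (n : ℝ) ^ K := by positivity
  refine ((hf n hn).const_mul (R' := ((m + 1) * C : ℕ) * (n : ℝ) ^ K) ?_ ?_).mono le_rfl ?_
  · push_cast
    nlinarith [mul_nonneg (Nat.cast_nonneg (α := ℝ) m) h0]
  · push_cast
    nlinarith [hα n hn]
  · rw [mul_assoc]
    exact Nat.le_mul_of_pos_left _ (Nat.succ_pos m)

lemma IsPolyRealized.comp_shallow {k : ℕ} {f : ℕ → (Fin d → ℝ) → ℝ} (hf : IsPolyRealized k f)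
    (N : ℕ → ℕ) (α w b : ℕ → ℕ → ℝ) (C K : ℕ) (hN : ∀ n, 0 < n → N n ≤ C * n)
    (hα : ∀ n, 0 < n → ∀ i < N n, |α n i| ≤ C * (n : ℝ) ^ K)
    (hw : ∀ n, 0 < n → ∀ i < N n, |w n i| ≤ C * (n : ℝ) ^ K)
    (hb : ∀ n, 0 < n → ∀ i < N n, |b n i| ≤ C * (n : ℝ) ^ K) :
    IsPolyRealized (k + 1)
      (fun n x => ∑ i ∈ Finset.range (N n), α n i * relu (w n i * f n x + b n i)) := by
  obtain ⟨C', K', hf⟩ := hf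
  refine ⟨2 * C' + 4 * C + 1, K + K', fun n hn => ?_⟩
  have h : (C : ℝ) * (n : ℝ) ^ K ≤ ((2 * C' + 4 * C + 1 : ℕ) : ℝ) * (n : ℝ) ^ (K + K') :=
    mul_pow_le_mul_pow hn (by positivity) (by exact_mod_cast (by omega)) (by omega)
  refine ((hf n hn).comp_shallow (R' := ((2 * C' + 4 * C + 1 : ℕ) : ℝ) * (n : ℝ) ^ (K + K'))
    ?_ ?_ (α n) (w n) (b n)
    (fun i hi => (hα n hn i hi).trans h) (fun i hi => (hw n hn i hi).trans h)
    (fun i hi => (hb n hn i hi).trans h)).mono le_rfl ?_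
  · exact mul_pow_le_mul_pow hn (by positivity) (by exact_mod_cast (by omega)) (by omega)
  · refine le_trans ?_ (le_mul_pow hn (by positivity))
    exact_mod_cast (by omega)
  · have := hN n hn
    nlinarith

lemma IsPolyRealized.relu {k : ℕ} {f : ℕ → (Fin d → ℝ) → ℝ} (hf : IsPolyRealized k f) :
    IsPolyRealized (k + 1) (fun n x => relu (f n x)) := by
  have := hf.comp_shallow (fun _ => 1) (fun _ _ => 1) (fun _ _ => 1) (fun _ _ => 0) 1 0
    (fun n hn => by omega) (by simp) (by simp) (by simp)
  simpa using this

lemma IsPolyRealized.succ {k : ℕ} {f : ℕ → (Fin d → ℝ) → ℝ} (hf : IsPolyRealized k f) :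
    IsPolyRealized (k + 1) f := by
  have h := hf.relu.add (((hf.const_mul (fun _ => -1) (B := 1) (by simp)).relu).const_mul
    (fun _ => -1) (B := 1) (by simp))
  convert h using 3 with n x
  have := relu_sub_relu_neg (f n x)
  rw [neg_one_mul, neg_one_mul]
  linarith

lemma IsPolyRealized.mono {k m : ℕ} {f : ℕ → (Fin d → ℝ) → ℝ} (hf : IsPolyRealized k f)
    (h : k ≤ m) : IsPolyRealized m f := by
  induction h with
  | refl => exact hf
  | step _ ih => exact ih.succ

lemma isPolyRealized_const (k : ℕ) (c : ℕ → ℝ) {B : ℝ} (hc : ∀ n, 0 < n → |c n| ≤ B) :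
    IsPolyRealized k (fun n (_ : Fin d → ℝ) => c n) := by
  have h : IsPolyRealized 0 (fun _ (_ : Fin d → ℝ) => (1 : ℝ)) :=
    ⟨2, 0, fun n hn => (isRealized_const le_rfl (by simp)).mono (by norm_num) (by omega)⟩
  simpa using (h.mono (Nat.zero_le k)).const_mul c hc

lemma isPolyRealized_coord (i : Fin d) :
    IsPolyRealized 0 (fun _ (x : Fin d → ℝ) => x i) :=
  ⟨4, 0, fun n hn => (isRealized_coord le_rfl i).mono (by norm_num) (by omega)⟩

lemma IsPolyRealized.pwLin {k : ℕ} {f : ℕ → (Fin d → ℝ) → ℝ} (hf : IsPolyRealized k f)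
    {T B : ℝ} (hT : 0 < T) (y : ℕ → ℕ → ℝ) (hy : ∀ n i, i ≤ n → |y n i| ≤ B) :
    IsPolyRealized (k + 1) (fun n x => pwLin (T / n) n (y n) (f n x)) := by
  obtain ⟨m, hm⟩ := exists_nat_ge (4 * B / T + T + 1)
  have hB : 0 ≤ B := (abs_nonneg _).trans (hy 0 0 le_rfl)
  have hBT : 0 ≤ 4 * B / T := by positivity
  have hs := hf.comp_shallow (fun n => n)
    (fun n i => ((y n (i + 1) - y n i) - (y n i - y n (i - 1))) / (T / n))
    (fun _ _ => 1) (fun n i => - (i * (T / n))) (m + 1) 1 (fun n _ => by nlinarith)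
    (fun n hn i hi => ?_) (fun n hn i hi => ?_) (fun n hn i hi => ?_)
  · convert (isPolyRealized_const (k + 1) (fun n => y n 0)
      (fun n _ => hy n 0 (Nat.zero_le _))).add hs using 3 with n x
    simp [_root_.pwLin, sub_eq_add_neg]
  · have hn' : (0 : ℝ) < n := by exact_mod_cast hn
    have a1 := abs_le.1 (hy n (i + 1) hi)
    have a2 := abs_le.1 (hy n i hi.le)
    have a3 := abs_le.1 (hy n (i - 1) (by omega))
    have h4 : |(y n (i + 1) - y n i) - (y n i - y n (i - 1))| ≤ 4 * B := by
      rw [abs_le]; constructor <;> linarith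
    rw [abs_div, abs_of_pos (show 0 < T / n by positivity), div_le_iff₀ (by positivity)]
    calc _ ≤ 4 * B := h4
      _ = (4 * B / T) * T := by field_simp
      _ ≤ ((m + 1 : ℕ) : ℝ) * T := by
        gcongr
        push_cast
        linarith
      _ = _ := by field_simp
  · have hn' : (1 : ℝ) ≤ n := by exact_mod_cast hn
    push_cast
    rw [abs_one, pow_one]
    nlinarith [Nat.cast_nonneg (α := ℝ) m]
  · have hn' : (1 : ℝ) ≤ n := by exact_mod_cast hn
    have hi' : (i : ℝ) ≤ n := by exact_mod_cast hi.le
    rw [abs_neg, abs_of_nonneg (by positivity)]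
    calc (i : ℝ) * (T / n) ≤ n * (T / n) := by gcongr
      _ = T := by field_simp
      _ ≤ ((m + 1 : ℕ) : ℝ) := by push_cast; linarith
      _ ≤ _ := le_mul_pow hn (by positivity)

lemma IsPolyRealized.sqApprox {k : ℕ} {f : ℕ → (Fin d → ℝ) → ℝ} (hf : IsPolyRealized k f)
    (q : ℕ) : IsPolyRealized (k + q) (fun n x => sqApprox n q (f n x)) := by
  induction q generalizing k f with
  | zero => exact hf
  | succ q ih =>
    have hB : ∀ n : ℕ, 0 < n → |1 / (n : ℝ) ^ 2| ≤ 1 := fun n hn => by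
      have : (1 : ℝ) ≤ n := by exact_mod_cast hn
      rw [abs_of_nonneg (by positivity)]
      exact div_le_one_of_le₀ (one_le_pow₀ this) (by positivity)
    have hI := hf.pwLin (B := 1) one_pos (fun n i => ((i : ℝ) / n) ^ 2) (fun n i hi => by
      rw [abs_of_nonneg (by positivity)]
      exact pow_le_one₀ (by positivity)
        (div_le_one_of_le₀ (by exact_mod_cast hi) (by positivity)))
    have hS := hf.pwLin (B := 1) one_pos (fun n i => ((i % 2 : ℕ) : ℝ)) (fun n i hi => by
      rw [abs_of_nonneg (by positivity)]
      exact_mod_cast Nat.lt_succ_iff.1 (Nat.mod_lt i two_pos))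
    have hq := (ih hS).const_mul (fun n => 1 / (n : ℝ) ^ 2) hB
    rw [show k + 1 + q = k + (q + 1) by ring] at hq
    exact ((hI.mono (by omega)).add ((hS.mono (by omega)).const_mul
      (fun n => -(1 / (n : ℝ) ^ 2)) (fun n hn => by rw [abs_neg]; exact hB n hn))).add hq

/-- The uniformly bounded functions `F n` are approximated on the cube, with error
`O(n ^ (-(s + 1)))`, by nets with `2 * k + 1` hidden layers, `O(n)` nonzero parameters, and
parameters bounded by a power of `n`. -/
def IsPolyApprox (s k : ℕ) (F : ℕ → (Fin d → ℝ) → ℝ) : Prop :=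
  ∃ f : ℕ → (Fin d → ℝ) → ℝ, IsPolyRealized k f ∧ ∃ C : ℝ, ∀ n : ℕ, 0 < n → ∀ x ∈ cube d,
    |f n x - F n x| ≤ C / (n : ℝ) ^ (s + 1) ∧ |F n x| ≤ C

lemma IsPolyRealized.isPolyApprox {s k : ℕ} {f : ℕ → (Fin d → ℝ) → ℝ} (hf : IsPolyRealized k f)
    {C : ℝ} (hC : ∀ n, 0 < n → ∀ x ∈ cube d, |f n x| ≤ C) : IsPolyApprox s k f := by
  refine ⟨f, hf, C, fun n hn x hx => ⟨?_, hC n hn x hx⟩⟩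
  have : 0 ≤ C := (abs_nonneg _).trans (hC n hn x hx)
  simp only [sub_self, abs_zero]
  positivity

lemma IsPolyApprox.mono {s k m : ℕ} {F : ℕ → (Fin d → ℝ) → ℝ} (h : IsPolyApprox s k F)
    (hm : k ≤ m) : IsPolyApprox s m F := by
  obtain ⟨f, hf, r⟩ := h
  exact ⟨f, hf.mono hm, r⟩

lemma IsPolyApprox.add {s k : ℕ} {F G : ℕ → (Fin d → ℝ) → ℝ} (hF : IsPolyApprox s k F)
    (hG : IsPolyApprox s k G) : IsPolyApprox s k (fun n x => F n x + G n x) := by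
  obtain ⟨f, hf, C, hC⟩ := hF
  obtain ⟨g, hg, C', hC'⟩ := hG
  refine ⟨_, hf.add hg, C + C', fun n hn x hx => ⟨?_, ?_⟩⟩
  · rw [add_div, add_sub_add_comm]
    exact (abs_add_le _ _).trans (add_le_add (hC n hn x hx).1 (hC' n hn x hx).1)
  · exact (abs_add_le _ _).trans (add_le_add (hC n hn x hx).2 (hC' n hn x hx).2)

lemma IsPolyApprox.const_mul {s k : ℕ} {F : ℕ → (Fin d → ℝ) → ℝ} (hF : IsPolyApprox s k F)
    (α : ℝ) : IsPolyApprox s k (fun n x => α * F n x) := by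
  obtain ⟨f, hf, C, hC⟩ := hF
  refine ⟨_, hf.const_mul (fun _ => α) (fun _ _ => le_rfl), |α| * C,
    fun n hn x hx => ⟨?_, ?_⟩⟩
  · rw [← mul_sub, abs_mul, mul_div_assoc]
    exact mul_le_mul_of_nonneg_left (hC n hn x hx).1 (abs_nonneg _)
  · rw [abs_mul]
    exact mul_le_mul_of_nonneg_left (hC n hn x hx).2 (abs_nonneg _)

lemma isPolyApprox_sum {s k : ℕ} {ι : Type} (S : Finset ι) {F : ι → ℕ → (Fin d → ℝ) → ℝ}
    (hF : ∀ i ∈ S, IsPolyApprox s k (F i)) : IsPolyApprox s k (fun n x => ∑ i ∈ S, F i n x) := by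
  induction S using Finset.induction_on with
  | empty =>
    simpa using (isPolyRealized_const k (fun _ => 0) (B := 0) (by simp)).isPolyApprox
      (C := 0) (by simp)
  | insert a S ha ih =>
    simp only [Finset.sum_insert ha]
    exact (hF a (by simp)).add (ih fun i hi => hF i (by simp [hi]))

lemma IsPolyApprox.sq {s k : ℕ} {F : ℕ → (Fin d → ℝ) → ℝ} (hF : IsPolyApprox s k F) :
    IsPolyApprox s (k + (s + 1)) (fun n x => F n x ^ 2) := by
  obtain ⟨f, hf, C, hC⟩ := hF
  set B : ℝ := 2 * |C| + 1 with hB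
  have hB0 : 0 < B := by positivity
  have hw : IsPolyRealized k (fun n x => 1 / 2 + 1 / (2 * B) * f n x) :=
    (isPolyRealized_const k (fun _ => 1 / 2) (fun _ _ => le_rfl)).add
      (hf.const_mul (fun _ => 1 / (2 * B)) (fun _ _ => le_rfl))
  have hp := ((((hw.sqApprox (s + 1)).const_mul (fun _ => 4) (fun _ _ => le_rfl)).add
    ((hw.mono (by omega)).const_mul (fun _ => -4) (fun _ _ => le_rfl))).add
    (isPolyRealized_const (k + (s + 1)) (fun _ => 1) (fun _ _ => le_rfl))).const_mul
      (fun _ => B ^ 2) (fun _ _ => le_rfl)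
  refine ⟨_, hp, 4 * B ^ 2 + C ^ 2 + 3 * C ^ 2, fun n hn x hx => ?_⟩
  obtain ⟨h1, h2⟩ := hC n hn x hx
  have hn' : (1 : ℝ) ≤ n := by exact_mod_cast hn
  have hC0 : 0 ≤ C := (abs_nonneg _).trans h2
  rw [abs_of_nonneg hC0] at hB
  have hpow : (1 : ℝ) ≤ (n : ℝ) ^ (s + 1) := one_le_pow₀ hn'
  have h3 : |f n x - F n x| ≤ C := h1.trans (div_le_self hC0 hpow)
  have h3' := abs_le.1 h3
  have h2' := abs_le.1 h2
  constructor
  · set w := 1 / 2 + 1 / (2 * B) * f n x with hw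
    have hfw : f n x = B * (2 * w - 1) := by rw [hw]; field_simp; ring
    have hw0 : 0 ≤ w := by
      have : 0 ≤ B * (2 * w) := by linarith
      linarith [(mul_nonneg_iff_of_pos_left hB0).1 this]
    have hw1 : w ≤ 1 := by
      have : 0 ≤ B * (2 - 2 * w) := by linarith
      linarith [(mul_nonneg_iff_of_pos_left hB0).1 this]
    have h4 := abs_sqApprox_sub_le hn (s + 1) hw0 hw1
    have h5 : (1 / (n : ℝ) ^ 2) ^ (s + 1) ≤ 1 / (n : ℝ) ^ (s + 1) := by
      rw [one_div, one_div, inv_pow]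
      gcongr
      nlinarith
    have h6 : |f n x ^ 2 - F n x ^ 2| ≤ C / (n : ℝ) ^ (s + 1) * (3 * C) := by
      rw [sq_sub_sq, abs_mul, mul_comm]
      refine mul_le_mul h1 ?_ (abs_nonneg _) (by positivity)
      rw [abs_le]; constructor <;> linarith
    have h7 : B ^ 2 * (4 * sqApprox n (s + 1) w + -4 * w + 1) - F n x ^ 2 =
        4 * B ^ 2 * (sqApprox n (s + 1) w - w ^ 2) + (f n x ^ 2 - F n x ^ 2) := by
      rw [hfw]; ring
    rw [h7]
    calc _ ≤ |4 * B ^ 2 * (sqApprox n (s + 1) w - w ^ 2)| + |f n x ^ 2 - F n x ^ 2| :=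
          abs_add_le _ _
      _ ≤ 4 * B ^ 2 * (1 / (n : ℝ) ^ (s + 1)) + C / (n : ℝ) ^ (s + 1) * (3 * C) := by
          rw [abs_mul, abs_of_nonneg (show 0 ≤ 4 * B ^ 2 by positivity)]
          gcongr
          exact h4.trans h5
      _ = (4 * B ^ 2 + 3 * C ^ 2) / (n : ℝ) ^ (s + 1) := by ring
      _ ≤ _ := by gcongr; nlinarith
  · rw [abs_pow]
    nlinarith [pow_le_pow_left₀ (abs_nonneg _) h2 2]

lemma IsPolyApprox.mul {s k : ℕ} {F G : ℕ → (Fin d → ℝ) → ℝ} (hF : IsPolyApprox s k F)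
    (hG : IsPolyApprox s k G) : IsPolyApprox s (k + (s + 1)) (fun n x => F n x * G n x) := by
  have h := ((hF.add hG).sq.const_mul (1 / 4)).add
    ((hF.add (hG.const_mul (-1))).sq.const_mul (-1 / 4))
  convert h using 3
  ring

lemma IsPolyApprox.horner {s k : ℕ} {Y : ℕ → (Fin d → ℝ) → ℝ} (hY : IsPolyApprox s k Y) (m : ℕ)
    (A : ℕ → ℕ → (Fin d → ℝ) → ℝ) (hA : ∀ j, IsPolyApprox s k (A j)) :
    IsPolyApprox s (k + m * (s + 1))
      (fun n x => ∑ j ∈ Finset.range (m + 1), A j n x * Y n x ^ j) := by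
  induction m generalizing A with
  | zero => simpa using hA 0
  | succ m ih =>
    have h := ((hA 0).mono (m := k + (m + 1) * (s + 1)) (by nlinarith)).add
      (((hY.mono (Nat.le_add_right _ _)).mul
      (ih (fun j => A (j + 1)) (fun j => hA _))).mono (m := k + (m + 1) * (s + 1)) (by nlinarith))
    convert h using 3 with n x
    rw [Finset.sum_range_succ', Finset.mul_sum, add_comm]
    congr 1
    · simp
    · exact Finset.sum_congr rfl fun j _ => by ring

end Families

section HolderSmooth

/-- `F` is `s` times differentiable on `I`, and its `s`-th derivative is Hölder continuous of
exponent `v`. -/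
def HolderSmooth (I : Set ℝ) (v : ℝ) : ℕ → (ℝ → ℝ) → Prop
  | 0, F => ∃ c, 0 ≤ c ∧ ∀ x ∈ I, ∀ y ∈ I, |F x - F y| ≤ c * |x - y| ^ v
  | s + 1, F => ∃ F' : ℝ → ℝ, (∀ x ∈ I, HasDerivWithinAt F (F' x) I x) ∧ HolderSmooth I v s F'

variable {a b a' b' v : ℝ}

lemma abs_sub_le_of_hasDerivWithinAt {F F' : ℝ → ℝ} {B : ℝ}
    (hF : ∀ x ∈ Set.Icc a b, HasDerivWithinAt F (F' x) (Set.Icc a b) x)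
    (hB : ∀ x ∈ Set.Icc a b, |F' x| ≤ B) {x y : ℝ} (hx : x ∈ Set.Icc a b)
    (hy : y ∈ Set.Icc a b) : |F x - F y| ≤ B * |x - y| :=
  (convex_Icc a b).norm_image_sub_le_of_norm_hasDerivWithin_le hF hB hy hx

lemma HolderSmooth.bounded (hv : 0 < v) {s : ℕ} {F : ℝ → ℝ}
    (hF : HolderSmooth (Set.Icc a b) v s F) : ∃ B, 0 ≤ B ∧ ∀ x ∈ Set.Icc a b, |F x| ≤ B := by
  cases s with
  | zero =>
    obtain ⟨c, hc, h⟩ := hF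
    refine ⟨|F a| + c * |b - a| ^ v, by positivity, fun x hx => ?_⟩
    have h1 := h x hx a ⟨le_rfl, hx.1.trans hx.2⟩
    have h2 : |x - a| ^ v ≤ |b - a| ^ v := by
      refine Real.rpow_le_rpow (abs_nonneg _) ?_ hv.le
      rw [abs_of_nonneg (by linarith [hx.1]), abs_of_nonneg (by linarith [hx.1, hx.2])]
      linarith [hx.2]
    have h3 : |F x| ≤ |F x - F a| + |F a| := by simpa using abs_add_le (F x - F a) (F a)
    nlinarith
  | succ s =>
    obtain ⟨F', h, -⟩ := hF
    obtain ⟨B, hB⟩ := isCompact_Icc.exists_bound_of_continuousOn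
      (fun x hx => (h x hx).continuousWithinAt : ContinuousOn F (Set.Icc a b))
    exact ⟨max B 0, le_max_right _ _, fun x hx => (hB x hx).trans (le_max_left _ _)⟩

lemma holderSmooth_zero_of_hasDerivWithinAt (hv1 : v ≤ 1) {F F' : ℝ → ℝ} {B : ℝ}
    (hB0 : 0 ≤ B) (hF : ∀ x ∈ Set.Icc a b, HasDerivWithinAt F (F' x) (Set.Icc a b) x)
    (hB : ∀ x ∈ Set.Icc a b, |F' x| ≤ B) : HolderSmooth (Set.Icc a b) v 0 F := by
  refine ⟨B * |b - a| ^ (1 - v), by positivity, fun x hx y hy => ?_⟩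
  refine (abs_sub_le_of_hasDerivWithinAt hF hB hx hy).trans ?_
  rw [mul_assoc]
  refine mul_le_mul_of_nonneg_left ?_ hB0
  have e : |x - y| = |x - y| ^ (1 - v) * |x - y| ^ v := by
    rw [← Real.rpow_add' (abs_nonneg _) (by simp)]
    simp
  have hle : |x - y| ≤ |b - a| := by
    rw [abs_of_nonneg (show 0 ≤ b - a by linarith [hx.1, hx.2]), abs_le]
    constructor <;> linarith [hx.1, hx.2, hy.1, hy.2]
  calc |x - y| = |x - y| ^ (1 - v) * |x - y| ^ v := e
    _ ≤ |b - a| ^ (1 - v) * |x - y| ^ v := by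
      gcongr

lemma HolderSmooth.of_succ (hv : 0 < v) (hv1 : v ≤ 1) {s : ℕ} {F : ℝ → ℝ}
    (hF : HolderSmooth (Set.Icc a b) v (s + 1) F) : HolderSmooth (Set.Icc a b) v s F := by
  induction s generalizing F with
  | zero =>
    obtain ⟨F', h, h'⟩ := hF
    obtain ⟨B, hB0, hB⟩ := h'.bounded hv
    exact holderSmooth_zero_of_hasDerivWithinAt hv1 hB0 h hB
  | succ s ih =>
    obtain ⟨F', h, h'⟩ := hF
    exact ⟨F', h, ih h'⟩

lemma HolderSmooth.add {I : Set ℝ} {s : ℕ} {F G : ℝ → ℝ} (hF : HolderSmooth I v s F)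
    (hG : HolderSmooth I v s G) : HolderSmooth I v s (fun x => F x + G x) := by
  induction s generalizing F G with
  | zero =>
    obtain ⟨c, hc, h⟩ := hF
    obtain ⟨c', hc', h'⟩ := hG
    refine ⟨c + c', by positivity, fun x hx y hy => ?_⟩
    rw [add_sub_add_comm, add_mul]
    exact (abs_add_le _ _).trans (add_le_add (h x hx y hy) (h' x hx y hy))
  | succ s ih =>
    obtain ⟨F', h, hF'⟩ := hF
    obtain ⟨G', h', hG'⟩ := hG
    exact ⟨_, fun x hx => (h x hx).add (h' x hx), ih hF' hG'⟩

lemma HolderSmooth.mul (hv : 0 < v) (hv1 : v ≤ 1) {s : ℕ} {F G : ℝ → ℝ}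
    (hF : HolderSmooth (Set.Icc a b) v s F) (hG : HolderSmooth (Set.Icc a b) v s G) :
    HolderSmooth (Set.Icc a b) v s (fun x => F x * G x) := by
  induction s generalizing F G with
  | zero =>
    obtain ⟨B, hB0, hB⟩ := hF.bounded hv
    obtain ⟨B', hB0', hB'⟩ := hG.bounded hv
    obtain ⟨c, hc, h⟩ := hF
    obtain ⟨c', hc', h'⟩ := hG
    refine ⟨c * B' + B * c', by positivity, fun x hx y hy => ?_⟩
    have e : F x * G x - F y * G y = (F x - F y) * G x + F y * (G x - G y) := by ring
    rw [e]
    refine (abs_add_le _ _).trans ?_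
    rw [abs_mul, abs_mul]
    have h1 := mul_le_mul (h x hx y hy) (hB' x hx) (abs_nonneg _) (by positivity)
    have h2 := mul_le_mul (hB y hy) (h' x hx y hy) (abs_nonneg _) hB0
    linarith
  | succ s ih =>
    have hF₀ := hF.of_succ hv hv1
    have hG₀ := hG.of_succ hv hv1
    obtain ⟨F', h, hF'⟩ := hF
    obtain ⟨G', h', hG'⟩ := hG
    exact ⟨_, fun x hx => (h x hx).mul (h' x hx), (ih hF' hG₀).add (ih hF₀ hG')⟩

lemma HolderSmooth.comp (hv : 0 < v) (hv1 : v ≤ 1) {s : ℕ} {F φ : ℝ → ℝ}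
    (hF : HolderSmooth (Set.Icc a b) v s F) (hφ : ∀ k, HolderSmooth (Set.Icc a' b') v k φ)
    (hm : Set.MapsTo φ (Set.Icc a' b') (Set.Icc a b)) :
    HolderSmooth (Set.Icc a' b') v s (fun x => F (φ x)) := by
  induction s generalizing F with
  | zero =>
    obtain ⟨φ', h', hφ'⟩ := hφ 1
    obtain ⟨B, hB0, hB⟩ := hφ'.bounded hv
    obtain ⟨c, hc, h⟩ := hF
    refine ⟨c * B ^ v, by positivity, fun x hx y hy => ?_⟩
    refine (h _ (hm hx) _ (hm hy)).trans ?_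
    rw [mul_assoc, ← Real.mul_rpow hB0 (abs_nonneg _)]
    gcongr
    exact abs_sub_le_of_hasDerivWithinAt h' hB hx hy
  | succ s ih =>
    obtain ⟨F', h, hF'⟩ := hF
    obtain ⟨φ', h', hφ'⟩ := hφ (s + 1)
    exact ⟨_, fun x hx => (h _ (hm hx)).comp x (h' x hx) hm, (ih hF').mul hv hv1 hφ'⟩

lemma ContDiffOn.holderSmooth_of_iteratedDerivWithin (hab : a < b) {s : ℕ} {F : ℝ → ℝ}
    (hF : ContDiffOn ℝ s F (Set.Icc a b))
    (h : HolderSmooth (Set.Icc a b) v 0 (iteratedDerivWithin s F (Set.Icc a b))) :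
    HolderSmooth (Set.Icc a b) v s F := by
  induction s generalizing F with
  | zero => simpa only [iteratedDerivWithin_zero] using h
  | succ s ih =>
    push_cast at hF
    obtain ⟨h1, -, h2⟩ := (contDiffOn_succ_iff_derivWithin (uniqueDiffOn_Icc hab)).1 hF
    rw [iteratedDerivWithin_succ'] at h
    exact ⟨_, fun x hx => (h1 x hx).hasDerivWithinAt, ih h2 h⟩

lemma ContDiffOn.holderSmooth (hv1 : v ≤ 1) (hab : a < b) {s : ℕ} {F : ℝ → ℝ}
    (hF : ContDiffOn ℝ (s + 1) F (Set.Icc a b)) : HolderSmooth (Set.Icc a b) v s F := by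
  induction s generalizing F with
  | zero =>
    obtain ⟨h1, -, h2⟩ := (contDiffOn_succ_iff_derivWithin (uniqueDiffOn_Icc hab)).1 hF
    obtain ⟨B, hB⟩ := isCompact_Icc.exists_bound_of_continuousOn h2.continuousOn
    exact holderSmooth_zero_of_hasDerivWithinAt hv1 (le_max_right B 0)
      (fun x hx => (h1 x hx).hasDerivWithinAt) (fun x hx => (hB x hx).trans (le_max_left _ _))
  | succ s ih =>
    obtain ⟨h1, -, h2⟩ := (contDiffOn_succ_iff_derivWithin (uniqueDiffOn_Icc hab)).1 hF
    push_cast at h2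
    exact ⟨_, fun x hx => (h1 x hx).hasDerivWithinAt, ih h2⟩

/-- Around each point of `I`, `F` is a polynomial of degree at most `s` with coefficients bounded
by `M`, up to `M` times the `r`-th power of the distance. -/
def HasTaylorBound (I : Set ℝ) (s : ℕ) (r : ℝ) (F : ℝ → ℝ) (M : ℝ) : Prop :=
  ∀ u₀ ∈ I, ∃ c : ℕ → ℝ, (∀ k, |c k| ≤ M) ∧
    ∀ u ∈ I, |F u - ∑ k ∈ Finset.range (s + 1), c k * (u - u₀) ^ k| ≤ M * |u - u₀| ^ r

lemma HolderSmooth.hasTaylorBound (hv : 0 < v) {s : ℕ} {F : ℝ → ℝ}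
    (hF : HolderSmooth (Set.Icc a b) v s F) :
    ∃ M, 0 ≤ M ∧ HasTaylorBound (Set.Icc a b) s (s + v) F M := by
  induction s generalizing F with
  | zero =>
    obtain ⟨B, hB0, hB⟩ := hF.bounded hv
    obtain ⟨c, hc, h⟩ := hF
    refine ⟨B + c, by positivity, fun u₀ hu₀ => ⟨fun _ => F u₀, fun _ => ?_, fun u hu => ?_⟩⟩
    · linarith [hB u₀ hu₀]
    · have h1 := h u hu u₀ hu₀
      have h2 : 0 ≤ B * |u - u₀| ^ v := by positivity
      simp only [zero_add, Finset.sum_range_one, pow_zero, mul_one, Nat.cast_zero]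
      linarith
  | succ s ih =>
    obtain ⟨B, hB0, hB⟩ := hF.bounded hv
    obtain ⟨F', h, hF'⟩ := hF
    obtain ⟨M, hM0, hM⟩ := ih hF'
    refine ⟨B + M, by positivity, fun u₀ hu₀ => ?_⟩
    obtain ⟨c, hc, hc'⟩ := hM u₀ hu₀
    refine ⟨fun k => Nat.casesOn k (F u₀) (fun k => c k / (k + 1)), ?_, fun u hu => ?_⟩
    · rintro (_ | k)
      · exact (hB u₀ hu₀).trans (by linarith)
      · have : |c k / (k + 1)| ≤ |c k| := by
          rw [abs_div, abs_of_pos (show (0 : ℝ) < k + 1 by positivity)]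
          exact div_le_self (abs_nonneg _) (by linarith [Nat.cast_nonneg (α := ℝ) k])
        exact this.trans ((hc k).trans (by linarith))
    · rw [Finset.sum_range_succ']
      simp only [pow_zero, mul_one]
      change |F u - (∑ k ∈ Finset.range (s + 1), c k / (k + 1) * (u - u₀) ^ (k + 1) + F u₀)| ≤ _
      set D : ℝ → ℝ := fun w => F w -
        ∑ k ∈ Finset.range (s + 1), c k / (k + 1) * (w - u₀) ^ (k + 1) with hD
      have hsub : Set.uIcc u₀ u ⊆ Set.Icc a b := Set.uIcc_subset_Icc hu₀ hu
      have hder : ∀ w ∈ Set.uIcc u₀ u, HasDerivWithinAt D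
          (F' w - ∑ k ∈ Finset.range (s + 1), c k * (w - u₀) ^ k) (Set.uIcc u₀ u) w := by
        intro w hw
        refine ((h w (hsub hw)).mono hsub).sub (HasDerivAt.hasDerivWithinAt ?_)
        refine HasDerivAt.fun_sum fun k _ => ?_
        have h1 := ((((hasDerivAt_id w).sub_const u₀).fun_pow (k + 1)).const_mul
          (c k / (k + 1)))
        refine h1.congr_deriv ?_
        push_cast
        rw [id]
        field_simp
      have hbd : ∀ w ∈ Set.uIcc u₀ u,
          ‖F' w - ∑ k ∈ Finset.range (s + 1), c k * (w - u₀) ^ k‖ ≤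
            M * |u - u₀| ^ ((s : ℝ) + v) := by
        intro w hw
        refine (hc' w (hsub hw)).trans ?_
        have : |w - u₀| ≤ |u - u₀| := Set.abs_sub_left_of_mem_uIcc hw
        gcongr
      have hmv := (convex_uIcc u₀ u).norm_image_sub_le_of_norm_hasDerivWithin_le hder hbd
        Set.left_mem_uIcc Set.right_mem_uIcc
      rw [Real.norm_eq_abs, Real.norm_eq_abs, mul_assoc,
        ← Real.rpow_add_one' (abs_nonneg _) (by positivity)] at hmv
      have e1 : D u₀ = F u₀ := by simp [hD]
      have e2 : F u - (∑ k ∈ Finset.range (s + 1), c k / (k + 1) * (u - u₀) ^ (k + 1) + F u₀) =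
          D u - D u₀ := by rw [e1, hD]; ring
      rw [e2]
      push_cast
      rw [show (s : ℝ) + 1 + v = s + v + 1 by ring]
      have : 0 ≤ B * |u - u₀| ^ ((s : ℝ) + v + 1) := by positivity
      linarith

lemma HasTaylorBound.congr {I : Set ℝ} {s : ℕ} {r M : ℝ} {F G : ℝ → ℝ}
    (hF : HasTaylorBound I s r F M) (h : ∀ x ∈ I, F x = G x) : HasTaylorBound I s r G M := by
  intro u₀ hu₀
  obtain ⟨c, hc, hc'⟩ := hF u₀ hu₀
  exact ⟨c, hc, fun u hu => by rw [← h u hu]; exact hc' u hu⟩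

lemma HasTaylorBound.abs_le {I : Set ℝ} {s : ℕ} {r M : ℝ} {F : ℝ → ℝ} (hr : 0 < r)
    (hF : HasTaylorBound I s r F M) {u : ℝ} (hu : u ∈ I) : |F u| ≤ M := by
  obtain ⟨c, hc, h⟩ := hF u hu
  have h1 := h u hu
  rw [Finset.sum_range_succ'] at h1
  simp only [sub_self, abs_zero, Real.zero_rpow hr.ne', mul_zero, ne_eq, Nat.add_eq_zero_iff,
    one_ne_zero, and_false, not_false_eq_true, zero_pow, Finset.sum_const_zero, zero_add, pow_zero,
    mul_one] at h1
  rw [sub_eq_zero.1 (abs_nonpos_iff.1 h1)]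
  exact hc 0

lemma HasTaylorBound.abs_sub_le {I : Set ℝ} {s : ℕ} {r M T : ℝ} {F : ℝ → ℝ} (hr : 0 < r)
    (hM : 0 ≤ M) (hT : 1 ≤ T)
    (hF : HasTaylorBound I s r F M) {u u₀ : ℝ} (hu : u ∈ I) (hu₀ : u₀ ∈ I) (hd : |u - u₀| ≤ T) :
    |F u - F u₀| ≤ M * |u - u₀| ^ r + s * M * T ^ s * |u - u₀| := by
  obtain ⟨c, hc, h⟩ := hF u₀ hu₀
  have h1 := h u₀ hu₀
  have h2 := h u hu
  rw [Finset.sum_range_succ'] at h1 h2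
  simp only [sub_self, abs_zero, Real.zero_rpow hr.ne', mul_zero, ne_eq, Nat.add_eq_zero_iff,
    one_ne_zero, and_false, not_false_eq_true, zero_pow, Finset.sum_const_zero, zero_add, pow_zero,
    mul_one] at h1 h2
  rw [← sub_eq_zero.1 (abs_nonpos_iff.1 h1)] at h2
  have h3 : |∑ k ∈ Finset.range s, c (k + 1) * (u - u₀) ^ (k + 1)| ≤
      s * M * T ^ s * |u - u₀| := by
    calc _ ≤ ∑ k ∈ Finset.range s, |c (k + 1) * (u - u₀) ^ (k + 1)| :=
          Finset.abs_sum_le_sum_abs _ _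
      _ ≤ ∑ k ∈ Finset.range s, M * (T ^ s * |u - u₀|) := by
          refine Finset.sum_le_sum fun k hk => ?_
          rw [abs_mul, abs_pow, pow_succ]
          have : |u - u₀| ^ k ≤ T ^ s := (pow_le_pow_left₀ (abs_nonneg _) hd k).trans
            (pow_le_pow_right₀ hT (Finset.mem_range.1 hk).le)
          gcongr
          exact hc _
      _ = _ := by simp; ring
  have e : F u - F u₀ = (F u - (∑ k ∈ Finset.range s, c (k + 1) * (u - u₀) ^ (k + 1) + F u₀)) +
      ∑ k ∈ Finset.range s, c (k + 1) * (u - u₀) ^ (k + 1) := by ring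
  rw [e]
  exact (abs_add_le _ _).trans (add_le_add h2 h3)

lemma HasTaylorBound.union {s : ℕ} {r M T : ℝ} {F : ℝ → ℝ} (hr : 0 < r) (hT : 1 ≤ T)
    (hM : 0 ≤ M) (h1 : HasTaylorBound (Set.Icc 0 1) s r F M)
    (h2 : HasTaylorBound (Set.Icc (1 / 2) T) s r F M) :
    ∃ M', 0 ≤ M' ∧ HasTaylorBound (Set.Icc 0 T) s r F M' := by
  have hbd : ∀ u ∈ Set.Icc 0 T, |F u| ≤ M := fun u hu => by
    rcases le_total u 1 with h | h
    · exact h1.abs_le hr ⟨hu.1, h⟩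
    · exact h2.abs_le hr ⟨by linarith, hu.2⟩
  have hfar : ∀ c : ℕ → ℝ, (∀ k, |c k| ≤ M) → ∀ u ∈ Set.Icc 0 T, ∀ u₀ ∈ Set.Icc 0 T,
      1 / 4 ≤ |u - u₀| → |F u - ∑ k ∈ Finset.range (s + 1), c k * (u - u₀) ^ k| ≤
        (M + (s + 1) * M * T ^ s) * 4 ^ r * |u - u₀| ^ r := by
    intro c hc u hu u₀ hu₀ hd
    have hle : |u - u₀| ≤ T := by
      rw [_root_.abs_le]
      constructor <;> linarith [hu.1, hu.2, hu₀.1, hu₀.2]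
    have h3 : |∑ k ∈ Finset.range (s + 1), c k * (u - u₀) ^ k| ≤ (s + 1) * M * T ^ s := by
      calc _ ≤ ∑ k ∈ Finset.range (s + 1), |c k * (u - u₀) ^ k| :=
            Finset.abs_sum_le_sum_abs _ _
        _ ≤ ∑ k ∈ Finset.range (s + 1), M * T ^ s := by
            refine Finset.sum_le_sum fun k hk => ?_
            rw [abs_mul, abs_pow]
            have : |u - u₀| ^ k ≤ T ^ s := (pow_le_pow_left₀ (abs_nonneg _) hle k).trans
              (pow_le_pow_right₀ hT (Nat.lt_succ_iff.1 (Finset.mem_range.1 hk)))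
            gcongr
            exact hc _
        _ = _ := by simp; ring
    have h4 : (1 : ℝ) ≤ 4 ^ r * |u - u₀| ^ r := by
      rw [← Real.mul_rpow (by norm_num) (abs_nonneg _)]
      exact Real.one_le_rpow (by linarith) hr.le
    calc _ ≤ |F u| + |∑ k ∈ Finset.range (s + 1), c k * (u - u₀) ^ k| := abs_sub _ _
      _ ≤ M + (s + 1) * M * T ^ s := add_le_add (hbd u hu) h3
      _ ≤ (M + (s + 1) * M * T ^ s) * (4 ^ r * |u - u₀| ^ r) :=
          le_mul_of_one_le_right (by positivity) h4
      _ = _ := by ring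
  have hK : 0 ≤ (M + (s + 1) * M * T ^ s) * 4 ^ r := by positivity
  refine ⟨M + (M + (s + 1) * M * T ^ s) * 4 ^ r, by positivity, fun u₀ hu₀ => ?_⟩
  have near : ∀ {X : ℝ} {u : ℝ}, X ≤ M * |u - u₀| ^ r →
      X ≤ (M + (M + (s + 1) * M * T ^ s) * 4 ^ r) * |u - u₀| ^ r := fun {X u} h => by
    have : 0 ≤ (M + (s + 1) * M * T ^ s) * 4 ^ r * |u - u₀| ^ r := by positivity
    linarith
  have far : ∀ {X : ℝ} {u : ℝ}, X ≤ (M + (s + 1) * M * T ^ s) * 4 ^ r * |u - u₀| ^ r →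
      X ≤ (M + (M + (s + 1) * M * T ^ s) * 4 ^ r) * |u - u₀| ^ r := fun {X u} h => by
    have : 0 ≤ M * |u - u₀| ^ r := by positivity
    linarith
  rcases le_total u₀ (3 / 4) with h | h
  · obtain ⟨c, hc, hc'⟩ := h1 u₀ ⟨hu₀.1, by linarith⟩
    refine ⟨c, fun k => (hc k).trans (by linarith), fun u hu => ?_⟩
    rcases le_total u 1 with hu1 | hu1
    · exact near (hc' u ⟨hu.1, hu1⟩)
    · refine far (hfar c hc u hu u₀ hu₀ ?_)
      rw [abs_of_nonneg] <;> linarith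
  · obtain ⟨c, hc, hc'⟩ := h2 u₀ ⟨by linarith, hu₀.2⟩
    refine ⟨c, fun k => (hc k).trans (by linarith), fun u hu => ?_⟩
    rcases le_total (1 / 2) u with hu1 | hu1
    · exact near (hc' u ⟨hu1, hu.2⟩)
    · refine far (hfar c hc u hu u₀ hu₀ ?_)
      rw [abs_sub_comm, abs_of_nonneg] <;> linarith

/-- A smooth function on the cube is smooth along the main diagonal. -/
lemma LipSmooth.holderSmooth_diagonal {d s : ℕ} (hd : 0 < d) {c₀ : ℝ} (hc₀ : 0 < c₀)
    {f : (Fin d → ℝ) → ℝ} (hf : LipSmooth d s v c₀ f) :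
    HolderSmooth (Set.Icc (-1) 1) v s (fun u => f fun _ => u) := by
  obtain ⟨hC, hH⟩ := hf
  let ℓ : ℝ →L[ℝ] (Fin d → ℝ) := ContinuousLinearMap.pi fun _ => ContinuousLinearMap.id ℝ ℝ
  have hℓ : ∀ u, ℓ u = fun _ => u := fun u => rfl
  have hpre : ℓ ⁻¹' cube d = Set.Icc (-1) 1 := by
    ext u
    simp only [Set.mem_preimage, hℓ, cube, Set.mem_ofPred_eq, Set.mem_Icc, ← abs_le]
    exact ⟨fun h => h ⟨0, hd⟩, fun h _ => h⟩
  have hcube : cube d = Set.Icc (fun _ => -1) (fun _ => 1) := by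
    ext x
    simp only [cube, Set.mem_ofPred_eq, Set.mem_Icc, Pi.le_def, abs_le]
    exact forall_and
  have hconv : Convex ℝ (cube d) := hcube ▸ convex_Icc _ _
  have hunique : UniqueDiffOn ℝ (cube d) := by
    refine uniqueDiffOn_convex hconv ⟨0, ?_⟩
    rw [hcube, ← Set.pi_univ_Icc, interior_pi_set Set.finite_univ]
    simp
  have hI : UniqueDiffOn ℝ (Set.Icc (-1 : ℝ) 1) := uniqueDiffOn_Icc (by norm_num)
  refine ContDiffOn.holderSmooth_of_iteratedDerivWithin (by norm_num) ?_ ?_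
  · rw [← hpre]
    exact hC.comp_continuousLinearMap ℓ
  · have hone : ∀ u : ℝ, ℓ u = ∑ i, u • Pi.single i (1 : ℝ) := fun u => by
      rw [hℓ]
      funext i
      simp [Finset.sum_apply, Pi.single_apply]
    have hD : ∀ u ∈ Set.Icc (-1 : ℝ) 1,
        iteratedDerivWithin s (fun u => f fun _ => u) (Set.Icc (-1) 1) u =
          ∑ k : Fin s → Fin d, iteratedFDerivWithin ℝ s f (cube d) (fun _ => u)
            (fun j => Pi.single (k j) 1) := by
      intro u hu
      have hmem : ℓ u ∈ cube d := by rw [← hpre] at hu; exact hu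
      have h := ℓ.iteratedFDerivWithin_comp_right hC hunique (hpre ▸ hI) hmem le_rfl
      rw [hpre] at h
      rw [iteratedDerivWithin_eq_iteratedFDerivWithin]
      change (iteratedFDerivWithin ℝ s (f ∘ ℓ) (Set.Icc (-1) 1) u) _ = _
      rw [h, ContinuousMultilinearMap.compContinuousLinearMap_apply]
      simp only [hone 1, one_smul]
      rw [ContinuousMultilinearMap.map_sum]
      rfl
    refine ⟨(d : ℝ) ^ s * c₀ * Real.sqrt d ^ v, by positivity, fun x hx y hy => ?_⟩
    rw [hD x hx, hD y hy, ← Finset.sum_sub_distrib]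
    have hmem : ∀ u ∈ Set.Icc (-1 : ℝ) 1, (fun _ => u) ∈ cube d := fun u hu _ => abs_le.2 hu
    have hn : enorm2 ((fun _ => x) - fun _ : Fin d => y) = Real.sqrt d * |x - y| := by
      simp [enorm2, Real.sqrt_sq_eq_abs]
    calc _ ≤ ∑ k : Fin s → Fin d, c₀ * (enorm2 ((fun _ => x) - fun _ : Fin d => y)) ^ v :=
          (Finset.abs_sum_le_sum_abs _ _).trans
            (Finset.sum_le_sum fun k _ => hH k _ (hmem x hx) _ (hmem y hy))
      _ = (d : ℝ) ^ s * c₀ * Real.sqrt d ^ v * |x - y| ^ v := by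
          rw [hn, Real.mul_rpow (Real.sqrt_nonneg _) (abs_nonneg _)]
          simp
          ring

end HolderSmooth

section PiecewiseTaylor

lemma HasTaylorBound.mono {I J : Set ℝ} {s : ℕ} {r M M' : ℝ} {F : ℝ → ℝ}
    (hF : HasTaylorBound I s r F M) (hJ : J ⊆ I) (hM : M ≤ M') : HasTaylorBound J s r F M' := by
  intro u₀ hu₀
  obtain ⟨c, hc, h⟩ := hF u₀ (hJ hu₀)
  exact ⟨c, fun k => (hc k).trans hM, fun u hu => (h u (hJ hu)).trans (by gcongr)⟩

lemma rpow_neg_half_mul_self (d : ℕ) : (d : ℝ) ^ (-(1 / 2 : ℝ)) * d = Real.sqrt d := by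
  rw [Real.rpow_neg (Nat.cast_nonneg d), ← Real.sqrt_eq_rpow, inv_mul_eq_div, Real.div_sqrt]

/-- The profile of a smooth radial function is smooth on the whole range of the radial variable,
also beyond `1`, where smoothness comes from the restriction to the diagonal. -/
lemma exists_hasTaylorBound_profile {d s : ℕ} (hd : 0 < d) {v c₀ : ℝ} (hv : 0 < v) (hv1 : v ≤ 1)
    (hc₀ : 0 < c₀) {f : (Fin d → ℝ) → ℝ} {g : (Fin 1 → ℝ) → ℝ} (hf : LipSmooth d s v c₀ f)
    (hg : LipSmooth 1 s v c₀ g)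
    (hradial : ∀ x ∈ cube d, f x = g fun _ => (d : ℝ) ^ (-(1 / 2 : ℝ)) * ∑ i, (x i) ^ 2) :
    ∃ M, 0 ≤ M ∧
      HasTaylorBound (Set.Icc 0 (Real.sqrt d)) s (s + v) (fun t => g fun _ => t) M := by
  have hr : 0 < (s : ℝ) + v := by positivity
  have hT : 1 ≤ Real.sqrt d := Real.one_le_sqrt.2 (by exact_mod_cast hd)
  obtain ⟨M₁, hM₁, h₁⟩ := (hg.holderSmooth_diagonal one_pos hc₀).hasTaylorBound hv
  have hφ : ∀ k, HolderSmooth (Set.Icc (1 / 2) (Real.sqrt d)) v k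
      (fun t => Real.sqrt (t / Real.sqrt d)) := fun k => by
    refine ContDiffOn.holderSmooth hv1 (by linarith) ?_
    refine ContDiffOn.sqrt (contDiffOn_id.div_const _) fun t ht => ?_
    have : 0 < t / Real.sqrt d := div_pos (by linarith [ht.1]) (by linarith)
    exact this.ne'
  have hm : Set.MapsTo (fun t => Real.sqrt (t / Real.sqrt d)) (Set.Icc (1 / 2) (Real.sqrt d))
      (Set.Icc (-1) 1) := fun t ht => by
    refine ⟨by linarith [Real.sqrt_nonneg (t / Real.sqrt d)], ?_⟩
    exact Real.sqrt_le_one.2 ((div_le_one (by linarith)).2 ht.2)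
  obtain ⟨M₂, hM₂, h₂⟩ :=
    ((hf.holderSmooth_diagonal hd hc₀).comp hv hv1 hφ hm).hasTaylorBound hv
  have h₂' : HasTaylorBound (Set.Icc (1 / 2) (Real.sqrt d)) s (s + v) (fun t => g fun _ => t) M₂ := by
    refine h₂.congr fun t ht => ?_
    have ht0 : 0 ≤ t / Real.sqrt d := div_nonneg (by linarith [ht.1]) (by linarith)
    rw [hradial _ fun _ => abs_le.2 (hm ht)]
    congr 1
    funext _
    simp only [Real.sq_sqrt ht0, Finset.sum_const, Finset.card_univ, Fintype.card_fin, nsmul_eq_mul]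
    rw [← mul_assoc, rpow_neg_half_mul_self]
    field_simp
  exact HasTaylorBound.union hr hT (le_max_of_le_left hM₁)
    (h₁.mono (Set.Icc_subset_Icc_left (by norm_num)) (le_max_left M₁ M₂))
    (h₂'.mono le_rfl (le_max_right M₁ M₂))

/-- The last grid index `j ≤ i` such that `4` divides `j + o`, or `0`. -/
def anchor (o i : ℕ) : ℕ := i - (i + o) % 4

/-- The indicator of the grid indices in the middle of the cells bounded by the anchors. -/
def bump (o i : ℕ) : ℝ := if (i + o) % 4 = 1 ∨ (i + o) % 4 = 2 then 1 else 0

lemma anchor_le (o i : ℕ) : anchor o i ≤ i := Nat.sub_le _ _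

lemma le_anchor_add (o i : ℕ) : i ≤ anchor o i + 3 := by unfold anchor; omega

lemma anchor_succ {o i : ℕ} (h : (i + o) % 4 ≠ 3) : anchor o (i + 1) = anchor o i := by
  unfold anchor; omega

lemma abs_bump_le (o i : ℕ) : |bump o i| ≤ 1 := by
  unfold bump; split_ifs <;> simp

lemma bump_nonneg (o i : ℕ) : 0 ≤ bump o i := by
  unfold bump; split_ifs <;> simp

lemma bump_add_bump (i : ℕ) : bump 1 i + bump 3 i = 1 := by
  unfold bump
  have : i % 4 < 4 := Nat.mod_lt _ (by norm_num)
  split_ifs <;> first | omega | norm_num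

/-- A piecewise Taylor polynomial of degree `s` with coefficients `c`, expanded at the anchors and
localized by the bump. -/
def localTaylor (c : ℝ → ℕ → ℝ) (s : ℕ) (h : ℝ) (n o : ℕ) (t : ℝ) : ℝ :=
  pwLin h n (bump o) t * ∑ j ∈ Finset.range (s + 1),
    pwLin h n (fun i => c (anchor o i * h) j) t *
      pwLin h n (fun i => ((i : ℝ) - anchor o i) * h) t ^ j

lemma abs_localTaylor_sub_le {c : ℝ → ℕ → ℝ} {s : ℕ} {h M r θ : ℝ} {n i : ℕ} {G : ℝ → ℝ}
    (hh : 0 < h) (hi : i < n) (h0 : 0 ≤ θ) (h1 : θ ≤ 1) (hM : 0 ≤ M) (hr : 0 < r)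
    (hc : ∀ u₀ ∈ Set.Icc 0 (n * h), ∀ u ∈ Set.Icc 0 (n * h),
      |G u - ∑ k ∈ Finset.range (s + 1), c u₀ k * (u - u₀) ^ k| ≤ M * |u - u₀| ^ r) (o : ℕ) :
    |localTaylor c s h n o ((i + θ) * h) - pwLin h n (bump o) ((i + θ) * h) * G ((i + θ) * h)| ≤
      pwLin h n (bump o) ((i + θ) * h) * (M * (4 * h) ^ r) := by
  unfold localTaylor
  simp only [pwLin_node hh hi _ h0 h1]
  by_cases hio : (i + o) % 4 = 3
  · have e1 : bump o i = 0 := by simp [bump, hio]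
    have e2 : bump o (i + 1) = 0 := by
      have : (i + 1 + o) % 4 = 0 := by omega
      simp [bump, this]
    simp [e1, e2]
  · have hin : (i : ℝ) + 1 ≤ n := by exact_mod_cast hi
    have hJ : (anchor o i : ℝ) ≤ i := by exact_mod_cast anchor_le o i
    have hJ' : (i : ℝ) ≤ anchor o i + 3 := by exact_mod_cast le_anchor_add o i
    have hψ : 0 ≤ bump o i + θ * (bump o (i + 1) - bump o i) := by
      nlinarith [bump_nonneg o i, bump_nonneg o (i + 1)]
    rw [← mul_sub, abs_mul, abs_of_nonneg hψ]
    refine mul_le_mul_of_nonneg_left ?_ hψ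
    have hdist : ((i : ℝ) + θ) * h - anchor o i * h = ((i : ℝ) + θ - anchor o i) * h := by ring
    have key := hc (anchor o i * h) ⟨by positivity, by gcongr; exact (anchor_le o i).trans hi.le⟩
      ((i + θ) * h)
      ⟨by positivity, by gcongr; linarith⟩
    rw [abs_sub_comm]
    simp only [anchor_succ hio, sub_self, mul_zero, add_zero]
    have hY : ((i : ℝ) - anchor o i) * h +
        θ * (((i + 1 : ℕ) : ℝ) * h - anchor o i * h - ((i : ℝ) * h - anchor o i * h)) =
          ((i : ℝ) + θ) * h - anchor o i * h := by
      push_cast; ring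
    simp only [← sub_mul] at hY ⊢
    rw [hY]
    simp only [sub_mul]
    refine key.trans ?_
    rw [hdist, abs_of_nonneg (mul_nonneg (by linarith) hh.le)]
    have : (i : ℝ) + θ - anchor o i ≤ 4 := by linarith
    gcongr
    exact mul_nonneg (by linarith) hh.le

lemma abs_localTaylor_add_sub_le {c : ℝ → ℕ → ℝ} {s : ℕ} {h M r t : ℝ} {n : ℕ} {G : ℝ → ℝ}
    (hh : 0 < h) (hn : 0 < n) (hM : 0 ≤ M) (hr : 0 < r)
    (hc : ∀ u₀ ∈ Set.Icc 0 (n * h), ∀ u ∈ Set.Icc 0 (n * h),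
      |G u - ∑ k ∈ Finset.range (s + 1), c u₀ k * (u - u₀) ^ k| ≤ M * |u - u₀| ^ r)
    (ht : t ∈ Set.Icc 0 (n * h)) :
    |localTaylor c s h n 1 t + localTaylor c s h n 3 t - G t| ≤ M * (4 * h) ^ r := by
  obtain ⟨i, hi, θ, h0, h1, rfl⟩ := exists_node hh hn ht.1 ht.2
  have hψ : pwLin h n (bump 1) ((i + θ) * h) + pwLin h n (bump 3) ((i + θ) * h) = 1 := by
    rw [pwLin_node hh hi _ h0 h1, pwLin_node hh hi _ h0 h1]
    linear_combination (1 - θ) * bump_add_bump i + θ * bump_add_bump (i + 1)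
  have e := abs_localTaylor_sub_le hh hi h0 h1 hM hr hc
  calc _ = |(localTaylor c s h n 1 ((i + θ) * h) -
          pwLin h n (bump 1) ((i + θ) * h) * G ((i + θ) * h)) +
        (localTaylor c s h n 3 ((i + θ) * h) -
          pwLin h n (bump 3) ((i + θ) * h) * G ((i + θ) * h))| := by
        congr 1
        linear_combination G ((i + θ) * h) * hψ
    _ ≤ pwLin h n (bump 1) ((i + θ) * h) * (M * (4 * h) ^ r) +
        pwLin h n (bump 3) ((i + θ) * h) * (M * (4 * h) ^ r) :=
        (abs_add_le _ _).trans (add_le_add (e 1) (e 3))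
    _ = _ := by rw [← add_mul, hψ, one_mul]

end PiecewiseTaylor

section Assembly

variable {d : ℕ}

/-- Truncation of `t` to `[0, T]`, written with two ReLUs. -/
def clip (T t : ℝ) : ℝ := T - relu (T - relu t)

lemma clip_mem {T : ℝ} (hT : 0 ≤ T) (t : ℝ) : clip T t ∈ Set.Icc 0 T := by
  unfold clip relu
  constructor
  · have : max (T - max t 0) 0 ≤ T := max_le (by linarith [le_max_right t 0]) hT
    linarith
  · linarith [le_max_right (T - max t 0) 0]

lemma abs_clip_sub_le {T t u : ℝ} (hu : u ∈ Set.Icc 0 T) : |clip T t - u| ≤ |t - u| := by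
  obtain ⟨h0, h1⟩ := hu
  unfold clip relu
  rcases max_cases t 0 with ⟨e1, _⟩ | ⟨e1, _⟩ <;> rw [e1] <;>
  [rcases max_cases (T - t) 0 with ⟨e2, _⟩ | ⟨e2, _⟩;
    rcases max_cases (T - 0) 0 with ⟨e2, _⟩ | ⟨e2, _⟩] <;> rw [e2] <;>
  rcases abs_cases (t - u) with ⟨e3, _⟩ | ⟨e3, _⟩ <;> rw [e3, abs_le] <;>
  constructor <;> linarith

lemma IsPolyRealized.clip {k : ℕ} {f : ℕ → (Fin d → ℝ) → ℝ} (hf : IsPolyRealized k f) (T : ℝ) :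
    IsPolyRealized (k + 2) (fun n x => clip T (f n x)) := by
  have h : ∀ {m : ℕ} {p : ℕ → (Fin d → ℝ) → ℝ}, IsPolyRealized m p →
      IsPolyRealized m (fun n x => T + -1 * p n x) := fun hp =>
    (isPolyRealized_const _ (fun _ => T) (fun _ _ => le_rfl)).add
      (hp.const_mul (fun _ => -1) (fun _ _ => le_rfl))
  have h2 := h (h hf.relu).relu
  convert h2 using 3 with n x
  simp only [_root_.clip]
  ring_nf

lemma IsPolyRealized.isPolyApprox_pwLin {s k : ℕ} {f : ℕ → (Fin d → ℝ) → ℝ}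
    (hf : IsPolyRealized k f) {T B : ℝ} (hT : 0 < T) (hfT : ∀ n x, f n x ∈ Set.Icc 0 T)
    (y : ℕ → ℕ → ℝ) (hy : ∀ n i, i ≤ n → |y n i| ≤ B) :
    IsPolyApprox s (k + 1) (fun n x => _root_.pwLin (T / n) n (y n) (f n x)) := by
  refine (hf.pwLin hT y hy).isPolyApprox (C := B) fun n hn x _ => ?_
  have hn' : (0 : ℝ) < n := by exact_mod_cast hn
  refine abs_pwLin_le (by positivity) hn (hfT n x).1 ?_ (hy n)
  rw [mul_div_cancel₀ _ hn'.ne']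
  exact (hfT n x).2

lemma IsPolyRealized.isPolyApprox_localTaylor {s k : ℕ} {f : ℕ → (Fin d → ℝ) → ℝ}
    (hf : IsPolyRealized k f) {T M : ℝ} (hT : 0 < T) (hfT : ∀ n x, f n x ∈ Set.Icc 0 T)
    {c : ℝ → ℕ → ℝ} (hc : ∀ u j, |c u j| ≤ M) (o : ℕ) :
    IsPolyApprox s (k + 1 + (s + 1) * (s + 1))
      (fun n x => localTaylor c s (T / n) n o (f n x)) := by
  have hΨ : IsPolyApprox s (k + 1) (fun n x => _root_.pwLin (T / n) n (bump o) (f n x)) :=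
    hf.isPolyApprox_pwLin hT hfT (fun _ => bump o) (fun _ i _ => abs_bump_le o i)
  have hA : ∀ j, IsPolyApprox s (k + 1) (fun n x =>
      _root_.pwLin (T / n) n (fun i => c (anchor o i * (T / n)) j) (f n x)) := fun j =>
    hf.isPolyApprox_pwLin hT hfT (fun n i => c (anchor o i * (T / n)) j) (fun _ _ _ => hc _ _)
  have hY : IsPolyApprox s (k + 1) (fun n x =>
      _root_.pwLin (T / n) n (fun i => ((i : ℝ) - anchor o i) * (T / n)) (f n x)) := by
    refine hf.isPolyApprox_pwLin (B := 3 * T) hT hfT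
      (fun n i => ((i : ℝ) - anchor o i) * (T / n)) fun n i _ => ?_
    have hJ : (anchor o i : ℝ) ≤ i := by exact_mod_cast anchor_le o i
    have hJ' : (i : ℝ) ≤ anchor o i + 3 := by exact_mod_cast le_anchor_add o i
    have h0 : 0 ≤ T / n := by positivity
    rw [abs_of_nonneg (mul_nonneg (by linarith) h0)]
    have h1 : T / n ≤ T := by
      rcases n.eq_zero_or_pos with rfl | hn
      · simpa using hT.le
      · exact div_le_self hT.le (by exact_mod_cast hn)
    exact mul_le_mul (by linarith) h1 h0 (by norm_num)
  refine ((hΨ.mono (Nat.le_add_right _ (s * (s + 1)))).mul (hY.horner s _ hA)).mono ?_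
  exact le_of_eq (by ring)

lemma isPolyApprox_radius (d s : ℕ) : IsPolyApprox s (s + 1)
    (fun _ (x : Fin d → ℝ) => (d : ℝ) ^ (-(1 / 2 : ℝ)) * ∑ i, (x i) ^ 2) := by
  refine IsPolyApprox.const_mul (isPolyApprox_sum Finset.univ fun i _ => ?_) _
  simpa using (((isPolyRealized_coord i).isPolyApprox (s := s) (C := 1)
    fun _ _ x hx => hx i).sq)

lemma radius_mem {x : Fin d → ℝ} (hx : x ∈ cube d) :
    (d : ℝ) ^ (-(1 / 2 : ℝ)) * ∑ i, (x i) ^ 2 ∈ Set.Icc 0 (Real.sqrt d) := by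
  refine ⟨by positivity, ?_⟩
  rw [← rpow_neg_half_mul_self]
  gcongr
  calc ∑ i, (x i) ^ 2 ≤ ∑ _i : Fin d, (1 : ℝ) :=
        Finset.sum_le_sum fun i _ => (sq_le_one_iff_abs_le_one _).2 (hx i)
    _ = d := by simp

lemma one_div_pow_le_rpow_neg {n s : ℕ} {v : ℝ} (hn : 0 < n) (hv1 : v ≤ 1) :
    1 / (n : ℝ) ^ (s + 1) ≤ (n : ℝ) ^ (-((s : ℝ) + v)) := by
  have hn' : (1 : ℝ) ≤ n := by exact_mod_cast hn
  rw [one_div, ← Real.rpow_natCast, ← Real.rpow_neg (by positivity)]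
  refine Real.rpow_le_rpow_of_exponent_le hn' ?_
  push_cast
  linarith

/-- A function with bounded Taylor remainders, composed with the normalized squared radius, is
approximated with error `O(n ^ (-r))` by nets with `O(n)` parameters of polynomial size. -/
lemma HasTaylorBound.exists_isPolyRealized_radial {s : ℕ} {v M : ℝ} {G : ℝ → ℝ} (hd : 0 < d)
    (hv : 0 < v) (hv1 : v ≤ 1) (hM : 0 ≤ M)
    (hG : HasTaylorBound (Set.Icc 0 (Real.sqrt d)) s (s + v) G M) :
    ∃ f : ℕ → (Fin d → ℝ) → ℝ, IsPolyRealized (s + 4 + (s + 1) * (s + 1)) f ∧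
      ∃ C : ℝ, ∀ n : ℕ, 0 < n → ∀ x ∈ cube d,
        |G ((d : ℝ) ^ (-(1 / 2 : ℝ)) * ∑ i, (x i) ^ 2) - f n x| ≤
          C * (n : ℝ) ^ (-((s : ℝ) + v)) := by
  have hr : 0 < (s : ℝ) + v := by positivity
  have hT : 1 ≤ Real.sqrt d := Real.one_le_sqrt.2 (by exact_mod_cast hd)
  have hrad : ∀ x ∈ cube d, _ := fun x hx => radius_mem hx
  obtain ⟨p, hp, C₁, hC₁⟩ := isPolyApprox_radius d s
  generalize Real.sqrt d = T at *
  generalize hτ : (fun x : Fin d → ℝ => (d : ℝ) ^ (-(1 / 2 : ℝ)) * ∑ i, (x i) ^ 2) = τ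
  replace hτ : ∀ x : Fin d → ℝ, (d : ℝ) ^ (-(1 / 2 : ℝ)) * ∑ i, (x i) ^ 2 = τ x := congrFun hτ
  simp only [hτ] at hrad hC₁ ⊢
  have hT0 : 0 < T := by linarith
  have hex : ∀ u₀, ∃ c : ℕ → ℝ, (∀ k, |c k| ≤ M) ∧ (u₀ ∈ Set.Icc 0 T → ∀ u ∈ Set.Icc 0 T,
      |G u - ∑ k ∈ Finset.range (s + 1), c k * (u - u₀) ^ k| ≤ M * |u - u₀| ^ ((s : ℝ) + v)) := by
    intro u₀
    by_cases hu₀ : u₀ ∈ Set.Icc 0 T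
    · obtain ⟨c, hc, h⟩ := hG u₀ hu₀
      exact ⟨c, hc, fun _ => h⟩
    · exact ⟨0, fun k => by simpa using hM, fun h => absurd h hu₀⟩
  choose c hc hc' using hex
  have hmem : ∀ n x, clip T (p n x) ∈ Set.Icc 0 T := fun n x => clip_mem hT0.le _
  have hLT := (hp.clip T).isPolyApprox_localTaylor (s := s) hT0 hmem hc
  obtain ⟨f, hf, C₂, hC₂⟩ := (hLT 1).add (hLT 3)
  refine ⟨f, hf, M * C₁ ^ ((s : ℝ) + v) + s * M * T ^ s * C₁ + M * (4 * T) ^ ((s : ℝ) + v) + C₂,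
    fun n hn x hx => ?_⟩
  have hn' : (1 : ℝ) ≤ n := by exact_mod_cast hn
  have hC₁0 : 0 ≤ C₁ := (abs_nonneg _).trans (hC₁ n hn x hx).2
  have hC₂0 : 0 ≤ C₂ := (abs_nonneg _).trans (hC₂ n hn x hx).2
  have hq := one_div_pow_le_rpow_neg (s := s) hn hv1
  have hq' : (1 / (n : ℝ) ^ (s + 1)) ^ ((s : ℝ) + v) ≤ (n : ℝ) ^ (-((s : ℝ) + v)) := by
    rw [Real.rpow_neg (by positivity), ← Real.inv_rpow (by positivity), ← one_div]
    gcongr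
    exact le_self_pow₀ hn' (Nat.succ_ne_zero s)
  have hin := (abs_clip_sub_le (hrad x hx)).trans (hC₁ n hn x hx).1
  rw [← mul_one_div] at hin
  have hnet := (hC₂ n hn x hx).1
  beta_reduce at hnet
  rw [← mul_one_div C₂] at hnet
  have hle : |clip T (p n x) - τ x| ≤ T := by
    have h1 := hmem n x
    have h2 := hrad x hx
    rw [_root_.abs_le]
    constructor <;> linarith [h1.1, h1.2, h2.1, h2.2]
  have hsub := hG.abs_sub_le hr hM hT (hmem n x) (hrad x hx) hle
  have hgrid : (n : ℝ) * (T / n) = T := mul_div_cancel₀ _ (by positivity)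
  have happ := abs_localTaylor_add_sub_le (h := T / n) (by positivity) hn hM hr
    (by rw [hgrid]; exact hc') (by rw [hgrid]; exact hmem n x)
  have h1 : M * |clip T (p n x) - τ x| ^ ((s : ℝ) + v) ≤
      M * C₁ ^ ((s : ℝ) + v) * (n : ℝ) ^ (-((s : ℝ) + v)) := by
    rw [mul_assoc]
    refine mul_le_mul_of_nonneg_left ?_ hM
    calc |clip T (p n x) - τ x| ^ ((s : ℝ) + v)
        ≤ (C₁ * (1 / (n : ℝ) ^ (s + 1))) ^ ((s : ℝ) + v) := by gcongr
      _ = C₁ ^ ((s : ℝ) + v) * (1 / (n : ℝ) ^ (s + 1)) ^ ((s : ℝ) + v) :=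
          Real.mul_rpow hC₁0 (by positivity)
      _ ≤ _ := by gcongr
  have h2 : s * M * T ^ s * |clip T (p n x) - τ x| ≤
      s * M * T ^ s * C₁ * (n : ℝ) ^ (-((s : ℝ) + v)) := by
    rw [mul_assoc _ C₁]
    have : 0 ≤ s * M * T ^ s := by positivity
    exact mul_le_mul_of_nonneg_left
      (hin.trans (mul_le_mul_of_nonneg_left hq hC₁0)) this
  have h3 : M * (4 * (T / n)) ^ ((s : ℝ) + v) =
      M * (4 * T) ^ ((s : ℝ) + v) * (n : ℝ) ^ (-((s : ℝ) + v)) := by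
    rw [← mul_div_assoc, Real.div_rpow (by positivity) (by positivity),
      Real.rpow_neg (by positivity)]
    ring
  have h4 : C₂ * (1 / (n : ℝ) ^ (s + 1)) ≤ C₂ * (n : ℝ) ^ (-((s : ℝ) + v)) := by gcongr
  rw [h3] at happ
  rw [abs_sub_comm] at hsub happ hnet
  have t1 := _root_.abs_sub_le (G (τ x)) (G (clip T (p n x))) (f n x)
  have t2 := _root_.abs_sub_le (G (clip T (p n x)))
    (localTaylor c s (T / n) n 1 (clip T (p n x)) + localTaylor c s (T / n) n 3 (clip T (p n x)))
    (f n x)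
  linarith

end Assembly

/-- Corollary 1 of the paper: extraction of smooth radial features.
Let `r = s + v`, `0 < v ≤ 1`, `c₀ > 0`.  For every radial `f* ∈ Lip^{(r,c₀)}` of the
form `f*(x) = g(d^{-1/2}((x⁽¹⁾)² + ⋯ + (x⁽ᵈ⁾)²))` with `g ∈ Lip^{(r,c₀)}` on `[-1,1]`,
there are `c₃, c₄, c₅ > 0` (depending only on `c₀, r, d, f*`) and `γ > 0`, such that
for every `n ∈ ℕ` there is a deep ReLU net with `4(d+s+2)(r+1)/τ_r + 8(d+s) + 20`
hidden layers, at most `c₃ n` nonzero free parameters each bounded in absolute value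
by `c₄ n^{max{1,(r+1)γ,γr/τ_r}}`, satisfying
`sup_{x ∈ [-1,1]^d} |f*(x) − h_{f*}(x)| ≤ c₅ n^{-r}`. -/
theorem deep_relu_radial_approx (d s : ℕ) (hd : 0 < d) (v c₀ : ℝ) (hv : 0 < v)
    (hv1 : v ≤ 1) (hc₀ : 0 < c₀)
    (fstar : (Fin d → ℝ) → ℝ) (g : (Fin 1 → ℝ) → ℝ)
    (hfstar : LipSmooth d s v c₀ fstar) (hg : LipSmooth 1 s v c₀ g)
    (hradial : ∀ x ∈ cube d,
      fstar x = g fun _ => (d : ℝ) ^ (-(1 / 2 : ℝ)) * ∑ i, (x i) ^ 2) :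
    ∃ γ c₃ c₄ c₅ : ℝ, 0 < γ ∧ 0 < c₃ ∧ 0 < c₄ ∧ 0 < c₅ ∧
      ∀ n : ℕ, 0 < n →
        ∃ net : ReLUNet d,
          (net.L : ℝ) ≤ 4 * ((d : ℝ) + s + 2) * (((s : ℝ) + v) + 1) / tauR s v
              + 8 * ((d : ℝ) + s) + 20 ∧
          (net.numParams : ℝ) ≤ c₃ * n ∧
          net.paramBound (c₄ * (n : ℝ) ^
            (max 1 (max ((((s : ℝ) + v) + 1) * γ) (γ * ((s : ℝ) + v) / tauR s v)))) ∧
          ∀ x ∈ cube d, |fstar x - net.eval x| ≤ c₅ * (n : ℝ) ^ (-((s : ℝ) + v)) := by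
  obtain ⟨M, hM, hG⟩ := exists_hasTaylorBound_profile hd hv hv1 hc₀ hfstar hg hradial
  obtain ⟨f, ⟨C, K, hf⟩, C', hC'⟩ := hG.exists_isPolyRealized_radial hd hv hv1 hM
  have hs : (0 : ℝ) ≤ s := Nat.cast_nonneg s
  have hd1 : (1 : ℝ) ≤ d := by exact_mod_cast hd
  refine ⟨K + 1, C + 1, C + 1, max C' 1, by positivity, by positivity, by positivity,
    by positivity, fun n hn => ?_⟩
  have hn' : (1 : ℝ) ≤ n := by exact_mod_cast hn
  obtain ⟨net, hL, hP, hR, he⟩ := (hf n hn).exists_net (by positivity)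
  refine ⟨net, ?_, ?_, ?_, fun x hx => ?_⟩
  · have hτ0 : 0 < tauR s v := by unfold tauR; split_ifs <;> linarith
    have hτ1 : tauR s v ≤ 1 := by unfold tauR; split_ifs <;> linarith
    rw [hL]
    push_cast
    have h1 : 4 * ((d : ℝ) + s + 2) * (s + v + 1) ≤
        4 * ((d : ℝ) + s + 2) * (s + v + 1) / tauR s v :=
      le_div_self (by positivity) hτ0 hτ1
    have h2 : 4 * ((s : ℝ) + 3) * (s + 1) ≤ 4 * ((d : ℝ) + s + 2) * (s + v + 1) := by
      gcongr 4 * ?_ * ?_ <;> linarith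
    nlinarith
  · calc (net.numParams : ℝ) ≤ ((C * n : ℕ) : ℝ) := by exact_mod_cast hP
      _ ≤ (C + 1) * n := by push_cast; gcongr; linarith
  · have hle : (C : ℝ) * (n : ℝ) ^ K ≤ (C + 1) * (n : ℝ) ^
        (max 1 (max ((((s : ℝ) + v) + 1) * (K + 1)) ((K + 1) * ((s : ℝ) + v) / tauR s v))) := by
      rw [← Real.rpow_natCast]
      gcongr
      · linarith
      · refine le_max_of_le_right (le_max_of_le_left ?_)
        nlinarith [Nat.cast_nonneg (α := ℝ) K]
    exact ⟨fun k hk i j => (hR.1 k hk i j).trans hle, fun k hk i => (hR.2.1 k hk i).trans hle,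
      fun i => (hR.2.2 i).trans hle⟩
  · rw [he, hradial x hx]
    exact (hC' n hn x hx).trans (by gcongr; exact le_max_left _ _)

end
end

section
/- There exists an absolute constant C > 0 such that for every ε ∈ (0,1) there is a deep ReLU net h : ℝ → ℝ with at most C(log(1/ε) + 1) hidden layers and at most C(log(1/ε) + 1) free parameters satisfying |t² − h(t)| ≤ ε for all t ∈ [0,1]. -/
open scoped Classical BigOperators

noncomputable section

/-- The tooth function on `[0,1]`, written with two ReLU units. -/
def tooth (y : ℝ) : ℝ := 2 * relu y - 4 * relu (y - 1 / 2)

lemma tooth_of_le {y : ℝ} (h0 : 0 ≤ y) (h : y ≤ 1 / 2) : tooth y = 2 * y := by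
  rw [tooth, relu, relu, max_eq_left h0, max_eq_right (by linarith)]
  ring

lemma tooth_of_ge {y : ℝ} (h : 1 / 2 ≤ y) : tooth y = 2 - 2 * y := by
  rw [tooth, relu, relu, max_eq_left (by linarith), max_eq_left (by linarith)]
  ring

lemma tooth_mem_Icc {y : ℝ} (hy : y ∈ Set.Icc (0 : ℝ) 1) : tooth y ∈ Set.Icc (0 : ℝ) 1 := by
  obtain ⟨h0, h1⟩ := hy
  rcases le_total y (1 / 2) with h | h
  · rw [tooth_of_le h0 h]
    constructor <;> linarith
  · rw [tooth_of_ge h]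
    constructor <;> linarith

lemma tooth_sub_sq {y : ℝ} (hy : 0 ≤ y) :
    y - y ^ 2 = tooth y / 4 + (tooth y - tooth y ^ 2) / 4 := by
  rcases le_total y (1 / 2) with h | h
  · rw [tooth_of_le hy h]
    ring
  · rw [tooth_of_ge h]
    ring

lemma iterate_tooth_mem_Icc {t : ℝ} (ht : t ∈ Set.Icc (0 : ℝ) 1) (k : ℕ) :
    tooth^[k] t ∈ Set.Icc (0 : ℝ) 1 := by
  induction k with
  | zero => exact ht
  | succ k ih =>
    rw [Function.iterate_succ_apply']
    exact tooth_mem_Icc ih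

/-- The piecewise linear interpolant of `t ^ 2` on the dyadic grid of mesh `2 ^ (-k)`. -/
def sqInterp (t : ℝ) : ℕ → ℝ
  | 0 => t
  | k + 1 => sqInterp t k - tooth (tooth^[k] t) / 4 ^ (k + 1)

lemma sqInterp_sub_sq {t : ℝ} (ht : t ∈ Set.Icc (0 : ℝ) 1) (k : ℕ) :
    sqInterp t k - t ^ 2 = (tooth^[k] t - (tooth^[k] t) ^ 2) / 4 ^ k := by
  induction k with
  | zero => simp [sqInterp]
  | succ k ih =>
    rw [tooth_sub_sq (iterate_tooth_mem_Icc ht k).1] at ih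
    rw [sqInterp, Function.iterate_succ_apply', sub_right_comm, ih]
    field_simp
    ring

lemma sq_le_sqInterp {t : ℝ} (ht : t ∈ Set.Icc (0 : ℝ) 1) (k : ℕ) : t ^ 2 ≤ sqInterp t k := by
  obtain ⟨h0, h1⟩ := iterate_tooth_mem_Icc ht k
  rw [← sub_nonneg, sqInterp_sub_sq ht]
  exact div_nonneg (by nlinarith) (by positivity)

lemma sqInterp_sub_sq_le {t : ℝ} (ht : t ∈ Set.Icc (0 : ℝ) 1) (k : ℕ) :
    sqInterp t k - t ^ 2 ≤ 1 / 4 ^ k := by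
  obtain ⟨h0, h1⟩ := iterate_tooth_mem_Icc ht k
  rw [sqInterp_sub_sq ht]
  gcongr
  nlinarith

/-- The widths of `squareNet`: one input, then three units per hidden layer. -/
def squareWidth : ℕ → ℕ
  | 0 => 1
  | _ + 1 => 3

/-- The weight matrices of `squareNet`. -/
def squareWeight : (k : ℕ) → Matrix (Fin (squareWidth (k + 1))) (Fin (squareWidth k)) ℝ
  | 0 => fun _ _ => 1
  | k + 1 => (!![2, -4, 0; 2, -4, 0; -2 / 4 ^ (k + 1), 4 / 4 ^ (k + 1), 1] :
      Matrix (Fin 3) (Fin 3) ℝ)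

/-- The ReLU net computing `sqInterp t m`. Layer `k + 1` holds the positive parts of
`y` and `y - 1 / 2` for `y = tooth^[k] t`, together with `sqInterp t k`. -/
def squareNet (m : ℕ) : ReLUNet 1 where
  L := m + 1
  width := squareWidth
  width_zero := rfl
  W := squareWeight
  b := fun _ => (![0, -1 / 2, 0] : Fin 3 → ℝ)
  a := (![0, 0, 1] : Fin 3 → ℝ)

lemma squareNet_hidden_succ (m : ℕ) {t : ℝ} (ht : t ∈ Set.Icc (0 : ℝ) 1) (k : ℕ) :
    (squareNet m).hidden (fun _ => t) (k + 1) =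
      (![relu (tooth^[k] t), relu (tooth^[k] t - 1 / 2), sqInterp t k] : Fin 3 → ℝ) := by
  induction k with
  | zero =>
    have hsum (i : Fin 3) : (∑ j, (squareNet m).W 0 i j *
        (squareNet m).hidden (fun _ => t) 0 j) = t := by
      change ∑ _j : Fin 1, (1 : ℝ) * t = t
      simp
    funext i
    change relu (_ + (![0, -1 / 2, 0] : Fin 3 → ℝ) i) = _
    rw [hsum i]
    change Fin 3 at i
    fin_cases i
    · simp
    · simp [sub_eq_add_neg, neg_div]
    · simp [sqInterp, relu, ht.1]
  | succ k ih =>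
    have hsum (i : Fin 3) : (∑ j, (squareNet m).W (k + 1) i j *
        (squareNet m).hidden (fun _ => t) (k + 1) j) =
        (![tooth (tooth^[k] t), tooth (tooth^[k] t), sqInterp t (k + 1)] : Fin 3 → ℝ) i := by
      rw [ih]
      change ∑ j : Fin 3, (!![2, -4, 0; 2, -4, 0; -2 / 4 ^ (k + 1), 4 / 4 ^ (k + 1), 1] :
        Matrix (Fin 3) (Fin 3) ℝ) i j *
        (![relu (tooth^[k] t), relu (tooth^[k] t - 1 / 2), sqInterp t k] : Fin 3 → ℝ) j = _
      rw [Fin.sum_univ_three]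
      fin_cases i <;> simp [sqInterp, tooth] <;> ring
    have hpos : 0 ≤ sqInterp t (k + 1) := (sq_nonneg t).trans (sq_le_sqInterp ht _)
    funext i
    change relu (_ + (![0, -1 / 2, 0] : Fin 3 → ℝ) i) = _
    rw [hsum i, Function.iterate_succ_apply']
    change Fin 3 at i
    fin_cases i
    · simp
    · simp [sub_eq_add_neg, neg_div]
    · simp [relu, hpos]

lemma squareNet_eval (m : ℕ) {t : ℝ} (ht : t ∈ Set.Icc (0 : ℝ) 1) :
    (squareNet m).eval (fun _ => t) = sqInterp t m := by
  change ∑ i : Fin 3, (![0, 0, 1] : Fin 3 → ℝ) i *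
    (squareNet m).hidden (fun _ => t) (m + 1) i = _
  rw [squareNet_hidden_succ m ht, Fin.sum_univ_three]
  simp

lemma squareWidth_le (k : ℕ) : squareWidth k ≤ 3 := by
  cases k <;> simp [squareWidth]

lemma squareNet_numParams_le (m : ℕ) : (squareNet m).numParams ≤ (m + 1) * 12 + 3 := by
  refine add_le_add ?_ ((Finset.card_filter_le _ _).trans ?_)
  · refine (Finset.sum_le_card_nsmul _ _ 12 fun k _ => ?_).trans_eq ?_
    · refine (add_le_add (Finset.card_filter_le _ _) (Finset.card_filter_le _ _)).trans ?_
      simp only [Finset.card_univ, Fintype.card_prod, Fintype.card_fin]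
      change squareWidth (k + 1) * squareWidth k + squareWidth (k + 1) ≤ 3 * 3 + 3
      exact add_le_add (Nat.mul_le_mul (squareWidth_le _) (squareWidth_le _)) (squareWidth_le _)
    · simp [squareNet]
  · rw [Finset.card_univ, Fintype.card_fin]
    exact squareWidth_le (m + 1)

/-- square gate, Lemma 2 of the paper / Proposition 2 of Yarotsky.
The function `t ↦ t²` on `[0,1]` can be `ε`-approximated by a deep ReLU net whose
depth and number of free parameters are both `O(log(1/ε))`. -/
theorem square_gate :
    ∃ C : ℝ, 0 < C ∧
      ∀ ε : ℝ, ε ∈ Set.Ioo (0 : ℝ) 1 →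
        ∃ net : ReLUNet 1,
          (net.L : ℝ) ≤ C * (Real.log (1 / ε) + 1) ∧
          (net.numParams : ℝ) ≤ C * (Real.log (1 / ε) + 1) ∧
          ∀ t ∈ Set.Icc (0 : ℝ) 1, |t ^ 2 - net.eval (fun _ => t)| ≤ ε := by
  refine ⟨27, by norm_num, fun ε ⟨hε0, hε1⟩ => ?_⟩
  have hlog : 0 ≤ Real.log (1 / ε) := Real.log_nonneg (one_le_one_div hε0 hε1.le)
  set m := ⌈Real.log (1 / ε)⌉₊
  have hm : (m : ℝ) < Real.log (1 / ε) + 1 := Nat.ceil_lt_add_one hlog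
  have hpow : 1 / (4 : ℝ) ^ m ≤ ε := by
    rw [one_div_le (by positivity) hε0]
    calc 1 / ε = Real.exp (Real.log (1 / ε)) := (Real.exp_log (by positivity)).symm
      _ ≤ Real.exp m := Real.exp_le_exp.mpr (Nat.le_ceil _)
      _ = Real.exp 1 ^ m := (Real.exp_one_pow m).symm
      _ ≤ 4 ^ m := by
        gcongr
        linarith [Real.exp_one_lt_d9]
  refine ⟨squareNet m, ?_, ?_, fun t ht => ?_⟩
  · have hL : ((squareNet m).L : ℝ) = m + 1 := by simp [squareNet]
    rw [hL]
    linarith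
  · have hN : ((squareNet m).numParams : ℝ) ≤ (m + 1) * 12 + 3 := by
      exact_mod_cast squareNet_numParams_le m
    linarith
  · rw [squareNet_eval m ht, abs_sub_comm, abs_of_nonneg (sub_nonneg.mpr (sq_le_sqInterp ht m))]
    exact (sqInterp_sub_sq_le ht m).trans hpow

end
end
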